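/- Let (W,S) be a finite irreducible Coxeter system of rank n with Coxeter number h, and for k ≥ 0 let SC_k(W) denote the number of saturated chains of length k in the noncrossing partition lattice L_W, i.e., sequences x₀ < x₁ < ⋯ < x_k of elements of L_W with ℓ_T(x_i) = ℓ_T(x₀) + i for all i. Then for every k ≥ 1, 2·SC_k(W) = h · ∑_{s∈S} SC_{k−1}(W_⟨s⟩). -/

import Mathlib

open scoped BigOperators

section Defs

variable {G : Type*} [Group G]

/-- `t` is a reflection with respect to the generating set `S`:
a conjugate of an element of `S`. -/
def IsReflectionOf (S : Set G) (t : G) : Prop :=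
  ∃ g : G, ∃ s ∈ S, t = g * s * g⁻¹

/-- The absolute length of `w`: the minimal length of a word in the
reflections (conjugates of elements of `S`) whose product is `w`. -/
noncomputable def absLength (S : Set G) (w : G) : ℕ :=
  sInf {k | ∃ l : List G, (∀ t ∈ l, IsReflectionOf S t) ∧ l.length = k ∧ l.prod = w}

/-- The absolute order: `u ≤ v` iff `ℓ_T(u) + ℓ_T(u⁻¹v) = ℓ_T(v)`. -/
def absLe (S : Set G) (u v : G) : Prop :=
  absLength S u + absLength S (u⁻¹ * v) = absLength S v

/-- `c` is a Coxeter element with respect to the set `S` of simple reflections: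
a product of all the elements of `S`, each occurring exactly once, in some order. -/
def IsCoxeterElementOf (S : Set G) (c : G) : Prop :=
  ∃ l : List G, l.Nodup ∧ (∀ x, x ∈ l ↔ x ∈ S) ∧ l.prod = c

/-- The rank-selected multichain count `C_{(j₁,…,j_m)}(W)`: the number of multichains
`x₁ ≤ ⋯ ≤ x_{m-1}` in the interval `[1,c]` of the absolute order whose sequence of
rank jumps (prepending `1` and appending `c`) is given by `j`. -/
noncomputable def chainCount (S : Set G) (c : G) {m : ℕ} (j : Fin m → ℕ) : ℕ :=
  Nat.card {y : Fin (m + 1) → G //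
    y 0 = 1 ∧ y (Fin.last m) = c ∧
    (∀ i, absLe S (y i) c) ∧
    (∀ i : Fin m, absLe S (y i.castSucc) (y i.succ)) ∧
    (∀ i : Fin m, absLength S (y i.succ) = absLength S (y i.castSucc) + j i)}

end Defs

section Cox

variable {B : Type*} {W : Type*} [Group W] {M : CoxeterMatrix B}

/-- The set of simple reflections of a Coxeter system. -/
def simpleSet (cs : CoxeterSystem M W) : Set W := Set.range cs.simple

/-- A Coxeter system is irreducible if its set of simple reflections is nonempty and cannot
be partitioned into two nonempty subsets such that every simple reflection in one commutes
with every simple reflection in the other. -/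
def IsIrreducibleCS (cs : CoxeterSystem M W) : Prop :=
  Nonempty B ∧
    ∀ A : Set B, (∀ a ∈ A, ∀ b ∈ Aᶜ, Commute (cs.simple a) (cs.simple b)) →
      A = ∅ ∨ A = Set.univ

/-- The standard parabolic subgroup `W_⟨s⟩` generated by the simple reflections
other than `cs.simple s`. -/
def parabolic (cs : CoxeterSystem M W) (s : B) : Subgroup W :=
  Subgroup.closure (Set.range cs.simple \ {cs.simple s})

/-- The set of simple reflections of the parabolic subgroup `W_⟨s⟩`, viewed as
elements of that subgroup. -/
def parabolicGens (cs : CoxeterSystem M W) (s : B) : Set (parabolic cs s) :=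
  {x | (x : W) ∈ Set.range cs.simple \ {cs.simple s}}

end Cox

section MoreCounts

variable {G : Type*} [Group G]

/-- `TW_k(W)`: the number of chains `1 = x₀ < x₁ < ⋯ < x_k` in the noncrossing partition
lattice `[1,c]` with `ℓ_T(xᵢ) = i` for all `i` (equivalently, the number of reduced
`T`-words of elements of absolute length `k` in `[1,c]`). -/
noncomputable def twCount (S : Set G) (c : G) (k : ℕ) : ℕ :=
  Nat.card {y : Fin (k + 1) → G //
    y 0 = 1 ∧ (∀ i, absLe S (y i) c) ∧
    (∀ i : Fin k, absLe S (y i.castSucc) (y i.succ)) ∧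
    (∀ i : Fin (k + 1), absLength S (y i) = (i : ℕ))}

/-- `NC(W)`: the number of elements of the noncrossing partition lattice `[1,c]`. -/
noncomputable def ncCount (S : Set G) (c : G) : ℕ :=
  Nat.card {w : G // absLe S w c}

/-- `E(W)`: the number of edges of the Hasse diagram of the noncrossing partition lattice
`[1,c]`, i.e. pairs `(x,y)` with `x ≤ y` in `[1,c]` and `ℓ_T(y) = ℓ_T(x) + 1`. -/
noncomputable def edgeCount (S : Set G) (c : G) : ℕ :=
  Nat.card {p : G × G // absLe S p.1 c ∧ absLe S p.2 c ∧ absLe S p.1 p.2 ∧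
    absLength S p.2 = absLength S p.1 + 1}

/-- `SC_k(W)`: the number of saturated chains `x₀ < x₁ < ⋯ < x_k` of length `k` in the
noncrossing partition lattice `[1,c]`, i.e. with `ℓ_T(xᵢ) = ℓ_T(x₀) + i` for all `i`. -/
noncomputable def scCount (S : Set G) (c : G) (k : ℕ) : ℕ :=
  Nat.card {y : Fin (k + 1) → G //
    (∀ i, absLe S (y i) c) ∧
    (∀ i : Fin k, absLe S (y i.castSucc) (y i.succ)) ∧
    (∀ i : Fin k, absLength S (y i.succ) = absLength S (y i.castSucc) + 1)}

end MoreCounts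

namespace CoxeterMatrix

variable {B : Type*} [Fintype B] [DecidableEq B] (M : CoxeterMatrix B)

/-- The canonical bilinear form on `B → ℝ` attached to a Coxeter matrix. -/
noncomputable def cosForm : LinearMap.BilinForm ℝ (B → ℝ) :=
  Matrix.toBilin' (Matrix.of fun i j => -Real.cos (Real.pi / M i j))

theorem cosForm_single_single (i j : B) :
    M.cosForm (Pi.single i 1) (Pi.single j 1) = -Real.cos (Real.pi / M i j) := by
  simp [cosForm, Matrix.toBilin'_single]

theorem cosForm_single_self (i : B) : M.cosForm (Pi.single i 1) (Pi.single i 1) = 1 := by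
  simp [cosForm_single_single]

theorem cosForm_comm (x y : B → ℝ) : M.cosForm x y = M.cosForm y x := by
  simp only [cosForm, Matrix.toBilin'_apply, Matrix.of_apply]
  rw [Finset.sum_comm]
  refine Finset.sum_congr rfl fun i _ => Finset.sum_congr rfl fun j _ => ?_
  rw [M.symmetric]; ring

theorem cosForm_single_nonpos {i j : B} (h : i ≠ j) :
    M.cosForm (Pi.single i 1) (Pi.single j 1) ≤ 0 := by
  rw [cosForm_single_single, neg_nonpos]
  have h1 : M i j ≠ 1 := M.off_diagonal i j h
  rcases Nat.eq_zero_or_pos (M i j) with h0 | h0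
  · simp [h0]
  · have h2 : (2 : ℝ) ≤ M i j := by exact_mod_cast (by omega : 2 ≤ M i j)
    apply Real.cos_nonneg_of_neg_pi_div_two_le_of_le
    · have : 0 ≤ Real.pi / M i j := by positivity
      linarith [Real.pi_pos]
    · exact div_le_div_of_nonneg_left Real.pi_pos.le (by norm_num) h2

/-- The reflection of the geometric representation attached to a simple generator. -/
noncomputable def simpleReflection (i : B) : (B → ℝ) ≃ₗ[ℝ] (B → ℝ) :=
  Module.reflection (x := Pi.single i 1) (f := (2 : ℝ) • M.cosForm (Pi.single i 1))
    (by simp [cosForm_single_self])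

theorem simpleReflection_apply (i : B) (x : B → ℝ) :
    M.simpleReflection i x = x - (2 * M.cosForm (Pi.single i 1) x) • Pi.single i 1 := by
  simp [simpleReflection, Module.reflection_apply]

open Polynomial in
theorem isLiftable_simpleReflection : M.IsLiftable M.simpleReflection := by
  intro i j
  ext1 z
  by_cases hij : i = j
  · subst hij
    simpa [simpleReflection] using Module.involutive_reflection _ z
  have h1 : M i j ≠ 1 := M.off_diagonal i j hij
  rcases Nat.eq_zero_or_pos (M i j) with h0 | h0
  · simp [h0]
  rw [simpleReflection, simpleReflection, Module.reflection_mul_reflection_pow_apply _ _ _ _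
    (2 * Real.cos (2 * (Real.pi / M i j))) ?_]
  swap
  · have hs : M j i = M i j := M.symmetric j i
    simp only [LinearMap.smul_apply, cosForm_single_single, hs, smul_eq_mul, Real.cos_two_mul]
    ring
  generalize hm : M i j = m at *
  obtain rfl | h3 : m = 2 ∨ 3 ≤ m := by omega
  · have hs : M j i = 2 := by rw [M.symmetric, hm]
    have e : 2 * (Real.pi / ((2 : ℕ) : ℝ)) = Real.pi := by push_cast; ring
    rw [e]
    simp [cosForm_single_single, hm, hs]
    norm_num [Chebyshev.S_one]
    module
  · set φ := 2 * (Real.pi / (m : ℝ)) with hφ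
    have hmpos : (0 : ℝ) < m := by positivity
    have hsin : 0 < Real.sin φ := by
      apply Real.sin_pos_of_pos_of_lt_pi
      · positivity
      · have : (3 : ℝ) ≤ m := by exact_mod_cast h3
        rw [hφ, mul_div_assoc', div_lt_iff₀ hmpos]
        nlinarith [Real.pi_pos]
    have key (n : ℤ) := Chebyshev.S_two_mul_real_cos φ n
    have hmφ : (m : ℝ) * φ = 2 * Real.pi := by rw [hφ]; field_simp
    have zero1 (n : ℤ) (h : 2 * (n + 1) = m) : (Chebyshev.S ℝ n).eval (2 * Real.cos φ) = 0 := by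
      have h' : ((n : ℝ) + 1) * φ = Real.pi := by
        have : (2 : ℝ) * (n + 1) = m := by exact_mod_cast h
        rw [← this] at hmφ; linarith
      have := key n
      rw [h', Real.sin_pi] at this
      exact (mul_eq_zero.1 this).resolve_right hsin.ne'
    have zero2 (n : ℤ) (h : 2 * n + 1 = m) : (Chebyshev.S ℝ n).eval (2 * Real.cos φ) +
        (Chebyshev.S ℝ (n - 1)).eval (2 * Real.cos φ) = 0 := by
      have h' : ((n : ℝ) + 1) * φ = 2 * Real.pi - n * φ := by
        have : (2 : ℝ) * n + 1 = m := by exact_mod_cast h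
        rw [← this] at hmφ; linarith
      have h1 := key n
      have h2 := key (n - 1)
      rw [h', Real.sin_two_pi_sub] at h1
      push_cast at h2
      rw [sub_add_cancel] at h2
      have : ((Chebyshev.S ℝ n).eval (2 * Real.cos φ) +
        (Chebyshev.S ℝ (n - 1)).eval (2 * Real.cos φ)) * Real.sin φ = 0 := by
          rw [add_mul, h1, h2]; ring
      exact (mul_eq_zero.1 this).resolve_right hsin.ne'
    obtain ⟨q, hq | hq⟩ : ∃ q : ℤ, (m : ℤ) = 2 * q ∨ (m : ℤ) = 2 * q + 1 :=
      ⟨m / 2, by omega⟩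
    · have e1 : ((m : ℤ) - 2) / 2 = q - 1 := by omega
      have e2 : ((m : ℤ) - 1) / 2 = q - 1 := by omega
      rw [e1, e2, zero1 (q - 1) (by omega)]
      simp
    · have e1 : ((m : ℤ) - 2) / 2 = q - 1 := by omega
      have e2 : ((m : ℤ) - 1) / 2 = q := by omega
      have e3 : ((m : ℤ) - 3) / 2 = q - 1 := by omega
      have e4 : (m : ℤ) / 2 = q := by omega
      rw [e1, e2, e3, e4, zero2 q (by omega)]
      simp

end CoxeterMatrix

namespace CoxeterSystem

variable {B : Type*} [Fintype B] [DecidableEq B] {W : Type*} [Group W] {M : CoxeterMatrix B}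
  (cs : CoxeterSystem M W)

/-- The geometric representation of a Coxeter group. -/
noncomputable def geomRep : W →* ((B → ℝ) ≃ₗ[ℝ] (B → ℝ)) :=
  cs.lift ⟨M.simpleReflection, M.isLiftable_simpleReflection⟩

theorem geomRep_simple (i : B) (x : B → ℝ) : cs.geomRep (cs.simple i) x =
    x - (2 * M.cosForm (Pi.single i 1) x) • Pi.single i 1 := by
  rw [geomRep, lift_apply_simple, M.simpleReflection_apply]

theorem geomRep_simple_single (i : B) :
    cs.geomRep (cs.simple i) (Pi.single i 1) = -Pi.single i 1 := by
  rw [geomRep_simple, M.cosForm_single_self]; module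

theorem cosForm_geomRep (w : W) (x y : B → ℝ) :
    M.cosForm (cs.geomRep w x) (cs.geomRep w y) = M.cosForm x y := by
  induction w using cs.simple_induction_left generalizing x y with
  | one => simp
  | mul_simple_left w i ih =>
    rw [map_mul, LinearEquiv.mul_apply, LinearEquiv.mul_apply, geomRep_simple, geomRep_simple,
      ← ih x y]
    generalize cs.geomRep w x = x
    generalize cs.geomRep w y = y
    simp only [map_sub, map_smul, LinearMap.sub_apply, LinearMap.smul_apply, smul_eq_mul,
      M.cosForm_single_self, M.cosForm_comm x (Pi.single i 1)]
    ring

/-- Conjugates of simple reflections act as reflections in the corresponding root. -/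
theorem geomRep_conj_simple (w : W) (i : B) (x : B → ℝ) :
    cs.geomRep (w * cs.simple i * w⁻¹) x =
      x - (2 * M.cosForm (cs.geomRep w (Pi.single i 1)) x) • cs.geomRep w (Pi.single i 1) := by
  have hx : x = cs.geomRep w (cs.geomRep w⁻¹ x) := by
    rw [← LinearEquiv.mul_apply, ← map_mul]; simp
  rw [map_mul, map_mul, LinearEquiv.mul_apply, LinearEquiv.mul_apply, geomRep_simple, map_sub,
    map_smul, ← hx, ← cs.cosForm_geomRep w, ← hx]

theorem simple_injective : Function.Injective cs.simple := by
  intro i j h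
  by_contra hij
  have h1 := cs.geomRep_simple_single i
  rw [h, geomRep_simple] at h1
  have := congrFun h1 i
  simp [hij] at this
  linarith

end CoxeterSystem

namespace CoxeterSystem

variable {B : Type*} [Fintype B] [DecidableEq B] {W : Type*} [Group W] {M : CoxeterMatrix B}
  (cs : CoxeterSystem M W)

/-- A `W`-invariant symmetric positive definite form, obtained by averaging. -/
theorem exists_invariant_form [Finite W] : ∃ A : LinearMap.BilinForm ℝ (B → ℝ),
    (∀ x y, A x y = A y x) ∧ (∀ x, x ≠ 0 → 0 < A x x) ∧
    ∀ (w : W) (x y), A (cs.geomRep w x) (cs.geomRep w y) = A x y := by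
  cases nonempty_fintype W
  refine ⟨∑ w : W, LinearMap.BilinForm.comp (Matrix.toBilin' (1 : Matrix B B ℝ))
    (cs.geomRep w).toLinearMap (cs.geomRep w).toLinearMap, fun x y => ?_, fun x hx => ?_,
    fun g x y => ?_⟩
  · simp [LinearMap.sum_apply, Matrix.toBilin'_apply', dotProduct_comm]
  · simp only [LinearMap.sum_apply, LinearMap.BilinForm.comp_apply, Matrix.toBilin'_apply',
      Matrix.one_mulVec, LinearEquiv.coe_coe]
    apply Finset.sum_pos _ Finset.univ_nonempty
    intro w _
    refine lt_of_le_of_ne (Finset.sum_nonneg fun i _ => mul_self_nonneg _) fun h => hx ?_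
    have := dotProduct_self_eq_zero.1 h.symm
    simpa using this
  · simp only [LinearMap.sum_apply, LinearMap.BilinForm.comp_apply, LinearEquiv.coe_coe,
      ← LinearEquiv.mul_apply, ← map_mul]
    exact Fintype.sum_equiv (Equiv.mulRight g) _ _ fun w => rfl

omit [Fintype B] in
theorem _root_.Pi.eq_sum_smul_single [Fintype B] (x : B → ℝ) :
    x = ∑ i, x i • (Pi.single i 1 : B → ℝ) := by
  ext j; simp [Finset.sum_apply, Pi.single_apply]

theorem cosForm_self_pos (cs : CoxeterSystem M W) [Finite W] {x : B → ℝ} (hx : x ≠ 0) : 0 < M.cosForm x x := by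
  obtain ⟨A, hsymm, hpos, hinv⟩ := cs.exists_invariant_form
  set a : B → ℝ := fun i => A (Pi.single i 1) (Pi.single i 1) with ha
  have hapos i : 0 < a i := hpos _ (by simp)
  have hA (i : B) (y : B → ℝ) : A (Pi.single i 1) y = M.cosForm (Pi.single i 1) y * a i := by
    have h := hinv (cs.simple i) (Pi.single i 1) y
    rw [geomRep_simple_single, geomRep_simple] at h
    simp only [map_neg, map_sub, map_smul, LinearMap.neg_apply, smul_eq_mul] at h
    simp only [ha]
    linarith
  have hB (i j : B) : M.cosForm (Pi.single i 1) (Pi.single j 1) =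
      A (Pi.single i 1) (Pi.single j 1) * ((√(a i))⁻¹ * (√(a j))⁻¹) := by
    by_cases h0 : M.cosForm (Pi.single i 1) (Pi.single j 1) = 0
    · rw [hA, h0]; simp
    · have h1 := hA i (Pi.single j 1)
      have h2 := hA j (Pi.single i 1)
      rw [hsymm, h1, M.cosForm_comm (Pi.single j 1)] at h2
      have h3 : a i = a j := mul_left_cancel₀ h0 h2
      rw [h1, ← h3, ← mul_inv, Real.mul_self_sqrt (hapos i).le, mul_assoc,
        mul_inv_cancel₀ (hapos i).ne', mul_one]
  set x' : B → ℝ := fun i => x i * (√(a i))⁻¹ with hx'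
  have h1 : M.cosForm x x = A x' x' := by
    conv_lhs => rw [Pi.eq_sum_smul_single x]
    conv_rhs => rw [Pi.eq_sum_smul_single x']
    simp only [map_sum, map_smul, LinearMap.sum_apply, LinearMap.smul_apply, smul_eq_mul, hB, hx',
      Finset.mul_sum]
    refine Finset.sum_congr rfl fun i _ => Finset.sum_congr rfl fun j _ => ?_
    ring
  rw [h1]
  refine hpos _ fun h => hx ?_
  ext i
  have := congrFun h i
  simp only [hx', Pi.zero_apply, mul_eq_zero, inv_eq_zero] at this
  exact this.resolve_right (Real.sqrt_pos.2 (hapos i)).ne'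

theorem coxeterMatrix_ne_zero (cs : CoxeterSystem M W) [Finite W] (i j : B) : M i j ≠ 0 := by
  intro h
  have hij : i ≠ j := by rintro rfl; simp at h
  have hji : M j i = 0 := by rw [M.symmetric, h]
  have := cs.cosForm_self_pos (x := Pi.single i 1 + Pi.single j 1) (fun h0 => by
    have := congrFun h0 i; simp [hij] at this)
  simp [M.cosForm_single_single, h, hji] at this

/-- The action of an alternating word on a simple root. -/
theorem geomRep_alternatingWord (i j : B) (k : ℕ) :
    Real.sin (Real.pi / M i j) •
      cs.geomRep (cs.wordProd (alternatingWord i j k)) (Pi.single i 1) =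
    if Even k then Real.sin ((k + 1) * (Real.pi / M i j)) • Pi.single i 1 +
        Real.sin (k * (Real.pi / M i j)) • Pi.single j 1
      else Real.sin (k * (Real.pi / M i j)) • Pi.single i 1 +
        Real.sin ((k + 1) * (Real.pi / M i j)) • Pi.single j 1 := by
  have hs : M j i = M i j := M.symmetric j i
  induction k with
  | zero => simp [alternatingWord]
  | succ k ih =>
    rw [alternatingWord_succ', cs.wordProd_cons, map_mul, LinearEquiv.mul_apply, ← map_smul, ih]
    have hsin : Real.sin ((k + 1 + 1) * (Real.pi / M i j)) =
        2 * Real.cos (Real.pi / M i j) * Real.sin ((k + 1) * (Real.pi / M i j)) -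
        Real.sin (k * (Real.pi / M i j)) := by
      have e1 : (k + 1 + 1) * (Real.pi / M i j) =
        (k + 1) * (Real.pi / M i j) + Real.pi / M i j := by ring
      have e2 : k * (Real.pi / M i j) =
        (k + 1) * (Real.pi / M i j) - Real.pi / M i j := by ring
      rw [e1, e2, Real.sin_add, Real.sin_sub]; ring
    rcases Nat.even_or_odd k with hk | hk
    · have hk' : ¬ Even (k + 1) := by simpa [Nat.even_add_one] using hk
      simp only [hk, hk', if_true, if_false, geomRep_simple, map_add, map_smul,
        M.cosForm_single_self]
      rw [M.cosForm_single_single, hs]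
      push_cast
      rw [hsin]
      module
    · have hk' : Even (k + 1) := hk.add_one
      have hk2 : ¬ Even k := by simpa using hk
      simp only [hk2, hk', if_true, if_false, geomRep_simple, map_add, map_smul,
        M.cosForm_single_self]
      rw [M.cosForm_single_single]
      push_cast
      rw [hsin]
      module

theorem geomRep_alternatingWord_nonneg (i j : B) (k : ℕ) (hij : i ≠ j) (hk : k < M i j) :
    ∃ a b : ℝ, 0 ≤ a ∧ 0 ≤ b ∧ cs.geomRep (cs.wordProd (alternatingWord i j k)) (Pi.single i 1) =
      a • Pi.single i 1 + b • Pi.single j 1 := by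
  have hm : (0 : ℝ) < M i j := by exact_mod_cast (by omega : 0 < M i j)
  have hm2 : (2 : ℝ) ≤ M i j := by
    have := M.off_diagonal i j hij
    exact_mod_cast (by omega : 2 ≤ M i j)
  have hkm : (k : ℝ) + 1 ≤ M i j := by exact_mod_cast hk
  have hs (r : ℝ) (hr : 0 ≤ r) (hr' : r ≤ M i j) : 0 ≤ Real.sin (r * (Real.pi / M i j)) := by
    apply Real.sin_nonneg_of_nonneg_of_le_pi
    · positivity
    · rw [mul_div_assoc', div_le_iff₀ hm, mul_comm Real.pi]
      exact mul_le_mul_of_nonneg_right hr' Real.pi_pos.le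
  have hpos : 0 < Real.sin (Real.pi / M i j) := by
    apply Real.sin_pos_of_pos_of_lt_pi (by positivity)
    rw [div_lt_iff₀ hm]
    nlinarith [Real.pi_pos]
  have h := cs.geomRep_alternatingWord i j k
  rw [← eq_inv_smul_iff₀ hpos.ne'] at h
  have h1 := hs k (by positivity) (by linarith)
  have h2 := hs (k + 1) (by positivity) hkm
  rw [h]
  split_ifs
  · exact ⟨_, _, mul_nonneg (inv_nonneg.2 hpos.le) h2, mul_nonneg (inv_nonneg.2 hpos.le) h1, by
      rw [smul_add, smul_smul, smul_smul]⟩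
  · exact ⟨_, _, mul_nonneg (inv_nonneg.2 hpos.le) h1, mul_nonneg (inv_nonneg.2 hpos.le) h2, by
      rw [smul_add, smul_smul, smul_smul]⟩

/-- Tits' theorem: if `w s_i` is longer than `w`, then `w` maps the simple root of `i` to a
positive root. -/
theorem geomRep_single_nonneg [Finite W] (w : W) (i : B)
    (h : cs.length w < cs.length (w * cs.simple i)) :
    0 ≤ cs.geomRep w (Pi.single i 1) := by
  induction hn : cs.length w using Nat.strong_induction_on generalizing w i with
  | _ n ih =>
  subst hn
  by_cases hw : w = 1
  · subst hw; simp
  obtain ⟨j, hj⟩ := cs.exists_rightDescent_of_ne_one hw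
  have hij : i ≠ j := by
    rintro rfl
    exact lt_asymm h hj
  have hM0 := cs.coxeterMatrix_ne_zero i j
  -- the longest alternating suffix of `w` ending in `j`
  let P : ℕ → Prop := fun k => ∃ v, w = v * cs.wordProd (alternatingWord i j k) ∧
    cs.length w = cs.length v + k
  have hPb (k) (hk : P k) : k ≤ cs.length w := by
    obtain ⟨v, -, h⟩ := hk; omega
  have hP1 : P 1 := ⟨w * cs.simple j, by simp [alternatingWord], by
    have := cs.isRightDescent_iff.1 hj; omega⟩
  classical
  set k := Nat.findGreatest P (cs.length w) with hkdef
  have hPk : P k := Nat.findGreatest_spec (hPb 1 hP1) hP1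
  have hk1 : 1 ≤ k := Nat.le_findGreatest (hPb 1 hP1) hP1
  have hmax (m) (hm : P m) : m ≤ k := Nat.le_findGreatest (hPb m hm) hm
  obtain ⟨v, hv, hlen⟩ := hPk
  have hsucc (a : B) (ha : a = if Even k then j else i) : cs.length v < cs.length (v * cs.simple a) := by
    by_contra hcon
    have hd : cs.length (v * cs.simple a) + 1 = cs.length v := by
      rcases cs.length_mul_simple v a with h | h <;> omega
    have := hmax (k + 1) ⟨v * cs.simple a, by
      rw [alternatingWord_succ', cs.wordProd_cons, ← ha]; simp [hv, mul_assoc], by omega⟩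
    omega
  have hpred (a : B) (ha : a = if Even (k - 1) then j else i) :
      cs.length v < cs.length (v * cs.simple a) := by
    by_contra hcon
    have hd : cs.length (v * cs.simple a) + 1 = cs.length v := by
      rcases cs.length_mul_simple v a with h | h <;> omega
    obtain ⟨k', hk'⟩ : ∃ k', k = k' + 1 := ⟨k - 1, by omega⟩
    rw [hk', alternatingWord_succ', cs.wordProd_cons] at hv
    simp only [hk', Nat.add_sub_cancel] at ha
    rw [← ha, ← mul_assoc] at hv
    have h1 := cs.length_mul_le (v * cs.simple a) (cs.wordProd (alternatingWord i j k'))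
    have h2 := cs.length_wordProd_le (alternatingWord i j k')
    rw [length_alternatingWord] at h2
    rw [← hv] at h1
    omega
  have hvi : ∀ a, (a = i ∨ a = j) → cs.length v < cs.length (v * cs.simple a) := by
    rcases Nat.even_or_odd k with hk | hk
    · have hk' : ¬ Even (k - 1) := by
        rw [Nat.not_even_iff_odd]; exact Nat.Even.sub_odd hk1 hk odd_one
      rintro a (rfl | rfl)
      · exact hpred _ (by simp [hk'])
      · exact hsucc _ (by simp [hk])
    · have hk' : Even (k - 1) := Nat.Odd.sub_odd hk odd_one
      rintro a (rfl | rfl)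
      · exact hsucc _ (by simp [hk])
      · exact hpred _ (by simp [hk'])
  have hkM : k < M i j := by
    by_contra hcon
    push Not at hcon
    by_cases hk2 : k ≤ M i j * 2
    · have e := cs.prod_alternatingWord_eq_prod_alternatingWord_sub i j k hk2
      have h2k : M i j * 2 - k ≤ k := by omega
      rcases Nat.eq_zero_or_pos (M i j * 2 - k) with h0 | h0
      · rw [h0] at e
        simp only [alternatingWord, wordProd_nil] at e
        rw [e, mul_one] at hv
        subst hv; omega
      · obtain ⟨k', hk'⟩ : ∃ k', M i j * 2 - k = k' + 1 := ⟨M i j * 2 - k - 1, by omega⟩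
        rw [hk', alternatingWord_succ, cs.wordProd_concat] at e
        have h1 : w * cs.simple i = v * cs.wordProd (alternatingWord i j k') := by
          rw [hv, e]; simp [mul_assoc]
        have h2 := cs.length_mul_le v (cs.wordProd (alternatingWord i j k'))
        have h3 := cs.length_wordProd_le (alternatingWord i j k')
        rw [length_alternatingWord] at h3
        rw [← h1] at h2
        omega
    · have h1 : ¬ cs.IsReduced (alternatingWord i j k) :=
        cs.not_isReduced_alternatingWord i j hM0 (by omega)
      have h2 := cs.length_wordProd_le (alternatingWord i j k)
      rw [length_alternatingWord] at h2
      have h3 := cs.length_mul_le v (cs.wordProd (alternatingWord i j k))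
      rw [← hv] at h3
      apply h1
      rw [IsReduced, length_alternatingWord]
      omega
  obtain ⟨a, b, ha, hb, hab⟩ := cs.geomRep_alternatingWord_nonneg i j k hij hkM
  have hi := ih _ (by omega) v i (hvi i (Or.inl rfl)) rfl
  have hj := ih _ (by omega) v j (hvi j (Or.inr rfl)) rfl
  rw [hv, map_mul, LinearEquiv.mul_apply, hab, map_add, map_smul, map_smul]
  exact add_nonneg (smul_nonneg ha hi) (smul_nonneg hb hj)

end CoxeterSystem

namespace CoxeterSystem

variable {B : Type*} [Fintype B] [DecidableEq B] {W : Type*} [Group W] {M : CoxeterMatrix B}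
  (cs : CoxeterSystem M W)

theorem geomRep_inv_apply_self (w : W) (x : B → ℝ) : cs.geomRep w⁻¹ (cs.geomRep w x) = x := by
  rw [← LinearEquiv.mul_apply, ← map_mul]; simp

theorem geomRep_mul_apply (w w' : W) (x : B → ℝ) :
    cs.geomRep (w * w') x = cs.geomRep w (cs.geomRep w' x) := by
  rw [map_mul, LinearEquiv.mul_apply]

theorem geomRep_single_nonpos [Finite W] (w : W) (i : B)
    (h : cs.length (w * cs.simple i) < cs.length w) :
    cs.geomRep w (Pi.single i 1) ≤ 0 := by
  have := cs.geomRep_single_nonneg (w * cs.simple i) i (by simpa using h)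
  rw [geomRep_mul_apply, geomRep_simple_single, map_neg] at this
  simpa using this

theorem geomRep_single_nonneg_or_nonpos [Finite W] (w : W) (i : B) :
    0 ≤ cs.geomRep w (Pi.single i 1) ∨ cs.geomRep w (Pi.single i 1) ≤ 0 := by
  rcases lt_or_gt_of_ne (cs.length_mul_simple_ne w i) with h | h
  · exact Or.inr (cs.geomRep_single_nonpos w i h)
  · exact Or.inl (cs.geomRep_single_nonneg w i h)

theorem geomRep_single_ne_zero (w : W) (i : B) : cs.geomRep w (Pi.single i 1) ≠ 0 := by
  simp

theorem geomRep_injective [Finite W] : Function.Injective cs.geomRep := by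
  rw [injective_iff_map_eq_one]
  intro w hw
  by_contra h1
  obtain ⟨i, hi⟩ := cs.exists_rightDescent_of_ne_one h1
  have := cs.geomRep_single_nonpos w i hi
  rw [hw] at this
  have := this i
  simp at this
  linarith

theorem eq_of_geomRep_eq [Finite W] {w w' : W} (h : ∀ x, cs.geomRep w x = cs.geomRep w' x) :
    w = w' :=
  cs.geomRep_injective (LinearEquiv.ext h)

/-- Two roots define the same reflection iff they agree up to sign. -/
theorem conj_simple_eq_iff [Finite W] (w w' : W) (i k : B) :
    w * cs.simple i * w⁻¹ = w' * cs.simple k * w'⁻¹ ↔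
      cs.geomRep w (Pi.single i 1) = cs.geomRep w' (Pi.single k 1) ∨
      cs.geomRep w (Pi.single i 1) = -cs.geomRep w' (Pi.single k 1) := by
  have hone (w : W) (i : B) : M.cosForm (cs.geomRep w (Pi.single i 1))
      (cs.geomRep w (Pi.single i 1)) = 1 := by
    rw [cosForm_geomRep, M.cosForm_single_self]
  constructor
  · intro h
    have h1 := cs.geomRep_conj_simple w i (cs.geomRep w (Pi.single i 1))
    rw [h, geomRep_conj_simple, hone] at h1
    have h3 := hone w i
    have h4 := hone w' k
    generalize cs.geomRep w (Pi.single i 1) = x at *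
    generalize cs.geomRep w' (Pi.single k 1) = y at *
    have h2 : x = M.cosForm y x • y := by
      have : (2 : ℝ) • x = (2 : ℝ) • (M.cosForm y x • y) := by
        rw [mul_one, sub_right_inj] at h1
        rw [smul_smul]
        exact h1.symm
      exact smul_right_injective _ (two_ne_zero (α := ℝ)) this
    have h5 : M.cosForm y x * M.cosForm y x = 1 := by
      have h6 : M.cosForm x x = M.cosForm y x * M.cosForm y x := by
        nth_rewrite 1 [h2]
        simp
      rw [← h6, h3]
    rcases mul_self_eq_one_iff.1 h5 with h | h
    · left; rw [h, one_smul] at h2; exact h2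
    · right; rw [h, neg_one_smul] at h2; exact h2
  · rintro (h | h)
    · exact cs.eq_of_geomRep_eq fun x => by rw [geomRep_conj_simple, h, geomRep_conj_simple]
    · exact cs.eq_of_geomRep_eq fun x => by
        rw [geomRep_conj_simple, h, geomRep_conj_simple]; simp

theorem cosForm_eq_sum (x y : B → ℝ) :
    M.cosForm x y = ∑ i, x i * M.cosForm (Pi.single i 1) y := by
  conv_lhs => rw [Pi.eq_sum_smul_single x]
  simp [LinearMap.sum_apply]

theorem geomRep_simple_apply_of_ne (i k : B) (x : B → ℝ) (h : k ≠ i) :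
    cs.geomRep (cs.simple i) x k = x k := by
  simp [geomRep_simple, h]

/-- A positive root made negative by a simple reflection is the corresponding simple root. -/
theorem geomRep_single_eq_of_nonpos [Finite W] (w : W) (i k : B)
    (h : 0 ≤ cs.geomRep w (Pi.single i 1))
    (h' : cs.geomRep (cs.simple k * w) (Pi.single i 1) ≤ 0) :
    cs.geomRep w (Pi.single i 1) = Pi.single k 1 := by
  have hone : M.cosForm (cs.geomRep w (Pi.single i 1)) (cs.geomRep w (Pi.single i 1)) = 1 := by
    rw [cosForm_geomRep, M.cosForm_single_self]
  rw [geomRep_mul_apply] at h'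
  generalize cs.geomRep w (Pi.single i 1) = x at *
  have hx : x = x k • Pi.single k 1 := by
    ext j
    by_cases hj : j = k
    · subst hj; simp
    · have h1 := h' j
      rw [cs.geomRep_simple_apply_of_ne k j x hj] at h1
      have h2 := h j
      simp only [Pi.zero_apply] at h1 h2
      simp [hj, le_antisymm h1 h2]
  have h1 : x k * x k = 1 := by
    rw [hx] at hone
    simpa [M.cosForm_single_self] using hone
  rcases mul_self_eq_one_iff.1 h1 with h2 | h2
  · rw [hx, h2, one_smul]
  · have := h k
    rw [h2] at this
    simp at this
    linarith

/-- The pairings of a vector with all simple roots. -/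
noncomputable def _root_.CoxeterMatrix.simplePairing (M : CoxeterMatrix B) :
    (B → ℝ) →ₗ[ℝ] (B → ℝ) :=
  LinearMap.pi fun i => M.cosForm (Pi.single i 1)

theorem simplePairing_injective (cs : CoxeterSystem M W) [Finite W] :
    Function.Injective M.simplePairing := by
  rw [injective_iff_map_eq_zero]
  intro x hx
  by_contra h
  have h1 := cs.cosForm_self_pos h
  rw [cosForm_eq_sum] at h1
  have (i : B) : M.cosForm (Pi.single i 1) x = 0 := congrFun hx i
  simp [this] at h1

theorem eq_zero_of_cosForm_single (cs : CoxeterSystem M W) [Finite W] {x : B → ℝ}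
    (h : ∀ i, M.cosForm (Pi.single i 1) x = 0) : x = 0 :=
  cs.simplePairing_injective <| by rw [map_zero]; exact funext h

theorem exists_weights (cs : CoxeterSystem M W) [Finite W] : ∃ ω : B → B → ℝ,
    ∀ i k, M.cosForm (Pi.single i 1) (ω k) = (Pi.single k 1 : B → ℝ) i := by
  have := LinearMap.injective_iff_surjective.1 cs.simplePairing_injective
  choose ω hω using fun k : B => this (Pi.single k 1)
  exact ⟨ω, fun i k => congrFun (hω k) i⟩

/-- The fundamental weights, i.e. the basis dual to the simple roots. -/
noncomputable def weight [Finite W] : B → B → ℝ := cs.exists_weights.choose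

variable [Finite W]

theorem cosForm_single_weight (i k : B) :
    M.cosForm (Pi.single i 1) (cs.weight k) = (Pi.single k 1 : B → ℝ) i :=
  cs.exists_weights.choose_spec i k

theorem cosForm_weight (x : B → ℝ) (k : B) : M.cosForm x (cs.weight k) = x k := by
  rw [cosForm_eq_sum]; simp [cosForm_single_weight, Pi.single_apply]

theorem eq_sum_smul_weight (x : B → ℝ) :
    x = ∑ k, M.cosForm (Pi.single k 1) x • cs.weight k := by
  rw [← sub_eq_zero]
  refine cs.eq_zero_of_cosForm_single fun i => ?_
  simp [cosForm_single_weight, Pi.single_apply]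

theorem geomRep_simple_weight_self (i : B) :
    cs.geomRep (cs.simple i) (cs.weight i) = cs.weight i - (2 : ℝ) • Pi.single i 1 := by
  simp [geomRep_simple, cosForm_single_weight]

theorem geomRep_simple_weight_of_ne {i k : B} (h : i ≠ k) :
    cs.geomRep (cs.simple i) (cs.weight k) = cs.weight k := by
  simp [geomRep_simple, cosForm_single_weight, h]

theorem geomRep_wordProd_weight (l : List B) (k : B) (h : k ∉ l) :
    cs.geomRep (cs.wordProd l) (cs.weight k) = cs.weight k := by
  induction l with
  | nil => simp
  | cons i l ih =>
    simp only [List.mem_cons, not_or] at h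
    rw [wordProd_cons, geomRep_mul_apply, ih h.2, cs.geomRep_simple_weight_of_ne (Ne.symm h.1)]

theorem geomRep_weight_le (w : W) (k : B) : cs.geomRep w (cs.weight k) ≤ cs.weight k := by
  induction hn : cs.length w using Nat.strong_induction_on generalizing w with
  | _ n ih =>
  subst hn
  by_cases hw : w = 1
  · subst hw; simp
  obtain ⟨i, hi⟩ := cs.exists_rightDescent_of_ne_one hw
  have h1 := ih _ hi _ rfl
  have hw' : w = w * cs.simple i * cs.simple i := by simp
  by_cases hik : i = k
  · subst hik
    have h2 := cs.geomRep_single_nonneg (w * cs.simple i) i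
      (by simpa using (show cs.length (w * cs.simple i) < cs.length w from hi))
    rw [hw', geomRep_mul_apply, geomRep_simple_weight_self, map_sub, map_smul]
    refine le_trans ?_ h1
    rw [sub_le_self_iff]
    exact smul_nonneg zero_le_two h2
  · rw [hw', geomRep_mul_apply, geomRep_simple_weight_of_ne _ hik]
    exact h1

theorem eq_of_geomRep_weight_eq {w : W} {i k : B}
    (h : cs.geomRep w (cs.weight i) = cs.weight k) : i = k := by
  have h1 : cs.weight k ≤ cs.weight i := h ▸ cs.geomRep_weight_le w i
  have h2 : cs.weight i ≤ cs.weight k := by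
    have := cs.geomRep_weight_le w⁻¹ k
    rwa [← h, geomRep_inv_apply_self, h] at this
  have h3 : cs.weight i = cs.weight k := le_antisymm h2 h1
  have h4 := cs.cosForm_single_weight i i
  rw [h3, cosForm_single_weight] at h4
  by_contra hne
  simp [hne] at h4

omit [Finite W] in
theorem geomRep_wordProd_apply_of_notMem (l : List B) (k : B) (h : k ∉ l) (x : B → ℝ) :
    cs.geomRep (cs.wordProd l) x k = x k := by
  induction l with
  | nil => simp
  | cons i l ih =>
    simp only [List.mem_cons, not_or] at h
    rw [wordProd_cons, geomRep_mul_apply, cs.geomRep_simple_apply_of_ne _ _ _ h.1, ih h.2]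

omit [Finite W] in
/-- The fixed vectors of a product of distinct simple reflections are orthogonal to the
corresponding simple roots. -/
theorem cosForm_eq_zero_of_fixed (l : List B) (hl : l.Nodup) (x : B → ℝ)
    (hx : cs.geomRep (cs.wordProd l) x = x) (i : B) (hi : i ∈ l) :
    M.cosForm (Pi.single i 1) x = 0 := by
  induction l generalizing i with
  | nil => simp at hi
  | cons a l ih =>
    rw [List.nodup_cons] at hl
    have h1 : cs.geomRep (cs.wordProd l) x = cs.geomRep (cs.simple a) x := by
      nth_rewrite 2 [← hx]
      rw [← geomRep_mul_apply, wordProd_cons]; simp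
    have ha : M.cosForm (Pi.single a 1) x = 0 := by
      have h2 := cs.geomRep_wordProd_apply_of_notMem l a hl.1 x
      rw [h1, geomRep_simple] at h2
      simpa using h2
    rw [List.mem_cons] at hi
    rcases hi with rfl | hi
    · exact ha
    · refine ih hl.2 ?_ i hi
      rw [h1, geomRep_simple, ha]; simp

omit [Fintype B] [DecidableEq B] [Finite W] in
theorem commute_simple_of_eq_two {i j : B} (h : M i j = 2) :
    Commute (cs.simple i) (cs.simple j) := by
  have h1 := cs.simple_mul_simple_pow i j
  rw [h, pow_two, mul_eq_one_iff_eq_inv, mul_inv_rev, inv_simple, inv_simple] at h1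
  exact h1

/-- Non-commuting simple reflections have simple roots at angle at least `2π/3`. -/
theorem cosForm_single_le_of_not_commute {i j : B}
    (h : ¬ Commute (cs.simple i) (cs.simple j)) :
    M.cosForm (Pi.single i 1) (Pi.single j 1) ≤ -(1 / 2) := by
  have hij : i ≠ j := by rintro rfl; exact h (Commute.refl _)
  have h0 := cs.coxeterMatrix_ne_zero i j
  have h1 := M.off_diagonal i j hij
  have h2 : M i j ≠ 2 := fun h2 => h (cs.commute_simple_of_eq_two h2)
  have h3 : (3 : ℝ) ≤ M i j := by exact_mod_cast (by omega : 3 ≤ M i j)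
  rw [M.cosForm_single_single, neg_le_neg_iff, ← Real.cos_pi_div_three]
  apply Real.cos_le_cos_of_nonneg_of_le_pi
  · positivity
  · linarith [Real.pi_pos]
  · exact div_le_div_of_nonneg_left Real.pi_pos.le (by norm_num) h3

end CoxeterSystem

namespace CoxeterSystem

variable {B : Type*} [Fintype B] [DecidableEq B] {W : Type*} [Group W] {M : CoxeterMatrix B}
  (cs : CoxeterSystem M W) [Finite W]

/-- A positive root made negative by the inverse of a word is one of the roots of the left
inversion sequence of that word. -/
theorem exists_append_of_nonpos (l : List B) (w : W) (i : B)
    (h : 0 ≤ cs.geomRep w (Pi.single i 1))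
    (h' : cs.geomRep ((cs.wordProd l)⁻¹ * w) (Pi.single i 1) ≤ 0) :
    ∃ l₁ k l₂, l = l₁ ++ k :: l₂ ∧
      cs.geomRep w (Pi.single i 1) = cs.geomRep (cs.wordProd l₁) (Pi.single k 1) := by
  induction l generalizing w with
  | nil =>
    simp only [wordProd_nil, inv_one, one_mul] at h'
    exact absurd (le_antisymm h' h) (cs.geomRep_single_ne_zero w i)
  | cons a l ih =>
    rw [wordProd_cons, mul_inv_rev, inv_simple, mul_assoc] at h'
    rcases cs.geomRep_single_nonneg_or_nonpos (cs.simple a * w) i with h1 | h1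
    · obtain ⟨l₁, k, l₂, rfl, h2⟩ := ih _ h1 h'
      refine ⟨a :: l₁, k, l₂, rfl, ?_⟩
      rw [wordProd_cons, geomRep_mul_apply, ← h2, ← geomRep_mul_apply]
      simp
    · exact ⟨[], a, l, rfl, by simpa using cs.geomRep_single_eq_of_nonpos w i a h h1⟩

omit [Finite W] in
/-- The Coxeter element fixes no nonzero vector. -/
theorem eq_zero_of_geomRep_wordProd_eq_self [Finite W] {l : List B} (hl : l.Nodup)
    (hall : ∀ i, i ∈ l) {x : B → ℝ} (hx : cs.geomRep (cs.wordProd l) x = x) : x = 0 :=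
  cs.eq_zero_of_cosForm_single fun i => cs.cosForm_eq_zero_of_fixed l hl x hx i (hall i)

theorem exists_pow_nonpos_nonneg {l : List B} (hl : l.Nodup) (hall : ∀ i, i ∈ l) (w : W)
    (i : B) : ∃ n : ℕ, cs.geomRep (cs.wordProd l ^ n * w) (Pi.single i 1) ≤ 0 ∧
      0 ≤ cs.geomRep (cs.wordProd l ^ (n + 1) * w) (Pi.single i 1) := by
  set c := cs.wordProd l with hc
  have hsum : ∑ n ∈ Finset.range (orderOf c), cs.geomRep (c ^ n * w) (Pi.single i 1) = 0 := by
    refine cs.eq_zero_of_geomRep_wordProd_eq_self hl hall ?_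
    rw [← hc, map_sum]
    have h1 := Finset.sum_range_succ (fun n => cs.geomRep (c ^ n * w) (Pi.single i 1)) (orderOf c)
    have h2 := Finset.sum_range_succ' (fun n => cs.geomRep (c ^ n * w) (Pi.single i 1)) (orderOf c)
    rw [h1] at h2
    simp only [pow_orderOf_eq_one, pow_zero, add_left_inj] at h2
    rw [h2]
    refine Finset.sum_congr rfl fun n _ => ?_
    rw [← geomRep_mul_apply, pow_succ', mul_assoc]
  have hpos : 0 < orderOf c := orderOf_pos c
  have hmod (n : ℕ) : cs.geomRep (c ^ (n % orderOf c) * w) (Pi.single i 1) =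
      cs.geomRep (c ^ n * w) (Pi.single i 1) := by rw [pow_mod_orderOf]
  by_contra! hcon
  have hneg (n : ℕ) (h : cs.geomRep (c ^ n * w) (Pi.single i 1) ≤ 0) (m : ℕ) (hm : n ≤ m) :
      cs.geomRep (c ^ m * w) (Pi.single i 1) ≤ 0 := by
    induction m, hm using Nat.le_induction with
    | base => exact h
    | succ m _ ih =>
      exact (cs.geomRep_single_nonneg_or_nonpos _ i).resolve_left (hcon m ih)
  by_cases hex : ∃ n, cs.geomRep (c ^ n * w) (Pi.single i 1) ≤ 0
  · obtain ⟨n, hn⟩ := hex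
    have hall' (m : ℕ) : cs.geomRep (c ^ m * w) (Pi.single i 1) ≤ 0 := by
      have := hneg n hn (m + orderOf c * n) (by nlinarith)
      rwa [← hmod, Nat.add_mul_mod_self_left, hmod] at this
    have := (Finset.sum_eq_zero_iff_of_nonpos fun m _ => hall' m).1 hsum 0 (by simpa using hpos)
    exact cs.geomRep_single_ne_zero _ _ this
  · push Not at hex
    have hall' (m : ℕ) : 0 ≤ cs.geomRep (c ^ m * w) (Pi.single i 1) :=
      (cs.geomRep_single_nonneg_or_nonpos _ i).resolve_right (hex m)
    have := (Finset.sum_eq_zero_iff_of_nonneg fun m _ => hall' m).1 hsum 0 (by simpa using hpos)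
    exact cs.geomRep_single_ne_zero _ _ this

/-- Every orbit of a Coxeter element on the roots meets its left inversion sequence. -/
theorem exists_pow_geomRep_eq {l : List B} (hl : l.Nodup) (hall : ∀ i, i ∈ l) (w : W)
    (i : B) : ∃ n < orderOf (cs.wordProd l), ∃ l₁ k l₂, l = l₁ ++ k :: l₂ ∧
      cs.geomRep w (Pi.single i 1) =
        cs.geomRep (cs.wordProd l ^ n * cs.wordProd l₁) (Pi.single k 1) := by
  obtain ⟨n, h1, h2⟩ := cs.exists_pow_nonpos_nonneg hl hall w i
  obtain ⟨l₁, k, l₂, h3, h4⟩ := cs.exists_append_of_nonpos l _ i h2 (by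
    rwa [pow_succ', mul_assoc, inv_mul_cancel_left])
  have hpos := orderOf_pos (cs.wordProd l)
  set c := cs.wordProd l
  obtain ⟨m, hm⟩ : ∃ m : ℕ, c ^ m = (c ^ (n + 1))⁻¹ := by
    obtain ⟨m, hm⟩ := (mem_powers_iff_mem_zpowers (x := c) (y := (c ^ (n + 1))⁻¹)).2
      (inv_mem (pow_mem (Subgroup.mem_zpowers c) _))
    exact ⟨m, hm⟩
  refine ⟨m % orderOf c, Nat.mod_lt _ hpos, l₁, k, l₂, h3, ?_⟩
  rw [geomRep_mul_apply, ← h4, pow_mod_orderOf, hm, ← geomRep_mul_apply, inv_mul_cancel_left]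

theorem geomRep_wordProd_weight_of_append {l₁ l₂ : List B} {k : B}
    (hl : (l₁ ++ k :: l₂).Nodup) :
    cs.geomRep (cs.wordProd (l₁ ++ k :: l₂)) (cs.weight k) =
      cs.weight k - (2 : ℝ) • cs.geomRep (cs.wordProd l₁) (Pi.single k 1) := by
  rw [List.nodup_append, List.nodup_cons] at hl
  have h1 : k ∉ l₁ := fun h => hl.2.2 k h k (by simp) rfl
  rw [wordProd_append, wordProd_cons, geomRep_mul_apply, geomRep_mul_apply,
    cs.geomRep_wordProd_weight l₂ k hl.2.1.1, geomRep_simple_weight_self, map_sub, map_smul,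
    cs.geomRep_wordProd_weight l₁ k h1]

theorem geomRep_pow_weight_rotate {a b : List B} (hl : (a ++ b).Nodup) (k : B) (n : ℕ)
    (h : cs.geomRep (cs.wordProd (a ++ b) ^ n) (cs.weight k) = cs.weight k) :
    cs.geomRep (cs.wordProd (b ++ a) ^ n) (cs.weight k) = cs.weight k := by
  have hinv (a : List B) (ha : k ∉ a) :
      cs.geomRep (cs.wordProd a)⁻¹ (cs.weight k) = cs.weight k := by
    nth_rewrite 1 [← cs.geomRep_wordProd_weight a k ha]
    rw [geomRep_inv_apply_self]
  by_cases ha : k ∈ a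
  · have hb : k ∉ b := fun hb => (List.nodup_append.1 hl).2.2 k ha k hb rfl
    have e : cs.wordProd (b ++ a) =
        cs.wordProd b * cs.wordProd (a ++ b) * (cs.wordProd b)⁻¹ := by
      simp [wordProd_append]; group
    rw [e, conj_pow, geomRep_mul_apply, geomRep_mul_apply, hinv b hb, h,
      cs.geomRep_wordProd_weight b k hb]
  · have e : cs.wordProd (b ++ a) =
        (cs.wordProd a)⁻¹ * cs.wordProd (a ++ b) * (cs.wordProd a)⁻¹⁻¹ := by
      simp [wordProd_append]
    rw [e, conj_pow, inv_inv, geomRep_mul_apply, geomRep_mul_apply,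
      cs.geomRep_wordProd_weight a k ha, h, hinv a ha]

/-- If a power of a Coxeter element fixes a fundamental weight, it fixes the neighbouring ones. -/
theorem geomRep_pow_weight_of_adjacent {l : List B} (hl : l.Nodup) (hall : ∀ i, i ∈ l) {i k : B}
    (hik : ¬ Commute (cs.simple i) (cs.simple k)) (n : ℕ)
    (h : cs.geomRep (cs.wordProd l ^ n) (cs.weight i) = cs.weight i) :
    cs.geomRep (cs.wordProd l ^ n) (cs.weight k) = cs.weight k := by
  obtain ⟨a, b, rfl⟩ := List.append_of_mem (hall i)
  have hl' : ((i :: b) ++ a).Nodup := (List.perm_append_comm.nodup_iff).1 hl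
  refine cs.geomRep_pow_weight_rotate hl' k n ?_
  have hi := cs.geomRep_pow_weight_rotate hl i n h
  have h1 : cs.geomRep (cs.wordProd (i :: b ++ a)) (cs.weight i) =
      cs.weight i - (2 : ℝ) • Pi.single i 1 := by
    have := cs.geomRep_wordProd_weight_of_append (l₁ := []) (k := i) (l₂ := b ++ a) hl'
    simpa using this
  set c := cs.wordProd (i :: b ++ a) with hc
  have hα : cs.geomRep (c ^ n) (Pi.single i 1) = Pi.single i 1 := by
    have h2 : cs.geomRep (c ^ n) (cs.geomRep c (cs.weight i)) = cs.geomRep c (cs.weight i) := by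
      rw [← geomRep_mul_apply, ← pow_succ, pow_succ', geomRep_mul_apply, hi]
    rw [h1, map_sub, hi, map_smul, sub_right_inj] at h2
    exact smul_right_injective _ (two_ne_zero (α := ℝ)) h2
  have hsum : ∑ j, -M.cosForm (Pi.single j 1) (Pi.single i 1) •
      (cs.weight j - cs.geomRep (c ^ n) (cs.weight j)) = 0 := by
    have h2 : ∑ j, M.cosForm (Pi.single j 1) (Pi.single i 1) •
        (cs.weight j - cs.geomRep (c ^ n) (cs.weight j)) = 0 := by
      simp only [smul_sub, Finset.sum_sub_distrib]
      rw [← cs.eq_sum_smul_weight]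
      simp only [← map_smul, ← map_sum]
      rw [← cs.eq_sum_smul_weight, hα, sub_self]
    simp only [neg_smul, Finset.sum_neg_distrib]
    rw [h2, neg_zero]
  have hnonneg (j : B) : 0 ≤ -M.cosForm (Pi.single j 1) (Pi.single i 1) •
      (cs.weight j - cs.geomRep (c ^ n) (cs.weight j)) := by
    by_cases hj : j = i
    · subst hj; rw [hi]; simp
    · refine smul_nonneg ?_ (sub_nonneg.2 (cs.geomRep_weight_le _ j))
      exact neg_nonneg.2 (M.cosForm_single_nonpos hj)
  have h3 := (Finset.sum_eq_zero_iff_of_nonneg fun j _ => hnonneg j).1 hsum k (Finset.mem_univ k)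
  have h4 := cs.cosForm_single_le_of_not_commute hik
  rw [M.cosForm_comm] at h4
  rcases smul_eq_zero.1 h3 with h5 | h5
  · linarith
  · exact (sub_eq_zero.1 h5).symm

theorem pow_eq_one_of_geomRep_weight_eq (hirr : ∀ A : Set B,
      (∀ a ∈ A, ∀ b ∈ Aᶜ, Commute (cs.simple a) (cs.simple b)) → A = ∅ ∨ A = Set.univ)
    {l : List B} (hl : l.Nodup) (hall : ∀ i, i ∈ l) {i : B} {n : ℕ}
    (h : cs.geomRep (cs.wordProd l ^ n) (cs.weight i) = cs.weight i) :
    cs.wordProd l ^ n = 1 := by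
  have hA := hirr {k | cs.geomRep (cs.wordProd l ^ n) (cs.weight k) = cs.weight k} (by
    intro a ha b hb
    by_contra hab
    exact hb (cs.geomRep_pow_weight_of_adjacent hl hall hab n ha))
  rcases hA with hA | hA
  · have : i ∈ (∅ : Set B) := hA ▸ h
    simp at this
  · refine cs.eq_of_geomRep_eq fun x => ?_
    have hk (k : B) : cs.geomRep (cs.wordProd l ^ n) (cs.weight k) = cs.weight k := by
      have : k ∈ (Set.univ : Set B) := trivial
      rwa [← hA] at this
    rw [cs.eq_sum_smul_weight x]
    simp only [map_sum, map_smul, hk]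
    simp

/-- The orbits of a Coxeter element on the roots are parametrised by its left inversion
sequence, and are regular. -/
theorem pow_mul_root_injective (hirr : ∀ A : Set B,
      (∀ a ∈ A, ∀ b ∈ Aᶜ, Commute (cs.simple a) (cs.simple b)) → A = ∅ ∨ A = Set.univ)
    {l : List B} (hl : l.Nodup) (hall : ∀ i, i ∈ l) {l₁ l₂ l₁' l₂' : List B} {i k : B}
    (h₁ : l = l₁ ++ i :: l₂) (h₂ : l = l₁' ++ k :: l₂') {n m : ℕ}
    (hn : n < orderOf (cs.wordProd l)) (hm : m < orderOf (cs.wordProd l))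
    (h : cs.geomRep (cs.wordProd l ^ n * cs.wordProd l₁) (Pi.single i 1) =
      cs.geomRep (cs.wordProd l ^ m * cs.wordProd l₁') (Pi.single k 1)) :
    i = k ∧ n = m := by
  have e₁ := cs.geomRep_wordProd_weight_of_append (h₁ ▸ hl)
  have e₂ := cs.geomRep_wordProd_weight_of_append (h₂ ▸ hl)
  rw [← h₁] at e₁
  rw [← h₂] at e₂
  set c := cs.wordProd l with hc
  have hw : cs.geomRep (c ^ n) (cs.weight i) = cs.geomRep (c ^ m) (cs.weight k) := by
    rw [← sub_eq_zero]
    refine cs.eq_zero_of_geomRep_wordProd_eq_self hl hall ?_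
    rw [← hc, map_sub, ← geomRep_mul_apply, ← geomRep_mul_apply, ← pow_succ', ← pow_succ',
      pow_succ, pow_succ, geomRep_mul_apply, geomRep_mul_apply _ (c ^ m), e₁, e₂, map_sub, map_sub,
      map_smul, map_smul, ← geomRep_mul_apply, ← geomRep_mul_apply, h]
    abel
  wlog hnm : n ≤ m generalizing i k n m l₁ l₁' l₂ l₂'
  · obtain ⟨h3, h4⟩ := this h₂ h₁ hm hn h.symm e₂ e₁ hw.symm (by omega)
    exact ⟨h3.symm, h4.symm⟩
  obtain ⟨d, rfl⟩ := Nat.exists_eq_add_of_le hnm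
  rw [pow_add, geomRep_mul_apply] at hw
  have hw' := (cs.geomRep (c ^ n)).injective hw
  have hik := cs.eq_of_geomRep_weight_eq hw'.symm
  subst hik
  have h1 := cs.pow_eq_one_of_geomRep_weight_eq hirr hl hall hw'.symm
  refine ⟨rfl, ?_⟩
  have := orderOf_dvd_of_pow_eq_one h1
  rcases Nat.eq_zero_or_pos d with h0 | h0
  · omega
  · have := Nat.le_of_dvd h0 this
    rw [← hc] at this
    omega

/-- Summing a function over the conjugates of the left inversion sequence of a Coxeter element
by its powers counts every reflection twice. -/
theorem sum_conj_leftInversion (hirr : ∀ A : Set B,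
      (∀ a ∈ A, ∀ b ∈ Aᶜ, Commute (cs.simple a) (cs.simple b)) → A = ∅ ∨ A = Set.univ)
    {l : List B} (hl : l.Nodup) (hall : ∀ i, i ∈ l) (l₁ l₂ : B → List B)
    (h : ∀ i, l = l₁ i ++ i :: l₂ i) (f : W → ℕ) (T : Finset W)
    (hT : ∀ t, t ∈ T ↔ ∃ w i, t = w * cs.simple i * w⁻¹) :
    ∑ i, ∑ n ∈ Finset.range (orderOf (cs.wordProd l)),
      f (cs.wordProd l ^ n * (cs.wordProd (l₁ i) * cs.simple i * (cs.wordProd (l₁ i))⁻¹) *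
        (cs.wordProd l ^ n)⁻¹) = 2 * ∑ t ∈ T, f t := by
  classical
  set c := cs.wordProd l with hc
  let g : B × ℕ → W := fun p => c ^ p.2 * cs.wordProd (l₁ p.1)
  let r : B × ℕ → W := fun p => g p * cs.simple p.1 * (g p)⁻¹
  let D : Finset (B × ℕ) := Finset.univ ×ˢ Finset.range (orderOf c)
  have hinj (p) (hp : p ∈ D) (q) (hq : q ∈ D)
      (hpq : cs.geomRep (g p) (Pi.single p.1 1) = cs.geomRep (g q) (Pi.single q.1 1)) :
      p = q := by
    simp only [D, Finset.mem_product, Finset.mem_range] at hp hq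
    obtain ⟨h1, h2⟩ := cs.pow_mul_root_injective hirr hl hall (h p.1) (h q.1) hp.2 hq.2 hpq
    exact Prod.ext h1 h2
  have hsurj (w : W) (i : B) : ∃ p ∈ D,
      cs.geomRep w (Pi.single i 1) = cs.geomRep (g p) (Pi.single p.1 1) := by
    obtain ⟨n, hn, a, k, b, hab, h2⟩ := cs.exists_pow_geomRep_eq hl hall w i
    have ha : a = l₁ k := by
      have hk := h k
      rw [hab] at hk hl
      exact (List.append_cons_inj_of_notMem
        (fun h => (List.nodup_append.1 hl).2.2 k h k (by simp) rfl)
        (List.nodup_cons.1 (List.nodup_append.1 hl).2.1).1).1 hk |>.1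
    exact ⟨(k, n), Finset.mem_product.2 ⟨Finset.mem_univ _, Finset.mem_range.2 hn⟩, by rw [h2, ha]⟩
  have hmaps : ∀ p ∈ D, r p ∈ T := fun p _ => (hT _).2 ⟨g p, p.1, rfl⟩
  have hcard (t) (ht : t ∈ T) : (D.filter fun p => r p = t).card = 2 := by
    obtain ⟨w, i, rfl⟩ := (hT t).1 ht
    obtain ⟨p, hp, hp'⟩ := hsurj w i
    obtain ⟨q, hq, hq'⟩ := hsurj (w * cs.simple i) i
    rw [geomRep_mul_apply, geomRep_simple_single, map_neg] at hq'
    rw [Finset.card_eq_two]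
    refine ⟨p, q, ?_, ?_⟩
    · rintro rfl
      rw [← hp', neg_eq_self] at hq'
      exact cs.geomRep_single_ne_zero _ _ hq'
    · ext x
      simp only [Finset.mem_filter, Finset.mem_insert, Finset.mem_singleton, r]
      rw [conj_simple_eq_iff]
      constructor
      · rintro ⟨hx, h1 | h1⟩
        · exact Or.inl (hinj _ hx _ hp (h1.trans hp'))
        · exact Or.inr (hinj _ hx _ hq (h1.trans hq'))
      · rintro (rfl | rfl)
        · exact ⟨hp, Or.inl hp'.symm⟩
        · exact ⟨hq, Or.inr hq'.symm⟩
  have hsum : ∑ p ∈ D, f (r p) = 2 * ∑ t ∈ T, f t := by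
    rw [← Finset.sum_fiberwise_of_maps_to hmaps, Finset.mul_sum]
    refine Finset.sum_congr rfl fun t ht => ?_
    rw [Finset.sum_congr rfl (g := fun _ => f t)
      (fun p hp => by rw [(Finset.mem_filter.1 hp).2]), Finset.sum_const, hcard t ht, smul_eq_mul]
  rw [← hsum, Finset.sum_product]
  refine Finset.sum_congr rfl fun i _ => Finset.sum_congr rfl fun n _ => ?_
  simp only [r, g, mul_inv_rev, mul_assoc]

end CoxeterSystem

section AbsLength

variable {G : Type*} [Group G] {S : Set G}

theorem IsReflectionOf.conj {t : G} (ht : IsReflectionOf S t) (g : G) :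
    IsReflectionOf S (g * t * g⁻¹) := by
  obtain ⟨w, s, hs, rfl⟩ := ht
  exact ⟨g * w, s, hs, by group⟩

theorem IsReflectionOf.mul_self (hinv : ∀ s ∈ S, s * s = 1) {t : G} (ht : IsReflectionOf S t) :
    t * t = 1 := by
  obtain ⟨w, s, hs, rfl⟩ := ht
  have : w * s * w⁻¹ * (w * s * w⁻¹) = w * (s * s) * w⁻¹ := by group
  rw [this, hinv s hs]
  group

theorem exists_reflection_word_of_closure_eq_top (hS : Subgroup.closure S = ⊤)
    (hinv : ∀ s ∈ S, s * s = 1) (w : G) :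
    ∃ l : List G, (∀ t ∈ l, IsReflectionOf S t) ∧ l.prod = w := by
  have hw : w ∈ Subgroup.closure S := hS ▸ Subgroup.mem_top w
  rw [← Subgroup.mem_toSubmonoid, Subgroup.closure_toSubmonoid] at hw
  obtain ⟨l, hl, rfl⟩ := Submonoid.exists_list_of_mem_closure hw
  refine ⟨l, fun t ht => ?_, rfl⟩
  rcases hl t ht with h | h
  · exact ⟨1, t, h, by simp⟩
  · have htt : t * t = 1 := by rw [← inv_inj, mul_inv_rev, hinv _ h, inv_one]
    exact ⟨1, t⁻¹, h, by simpa using eq_inv_of_mul_eq_one_left htt⟩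

theorem absLength_prod_le {l : List G} (hl : ∀ t ∈ l, IsReflectionOf S t) :
    absLength S l.prod ≤ l.length :=
  Nat.sInf_le ⟨l, hl, rfl, rfl⟩

theorem exists_absLength_word
    (hgen : ∀ w : G, ∃ l : List G, (∀ t ∈ l, IsReflectionOf S t) ∧ l.prod = w) (w : G) :
    ∃ l : List G, (∀ t ∈ l, IsReflectionOf S t) ∧ l.length = absLength S w ∧ l.prod = w := by
  obtain ⟨l, hl, hw⟩ := hgen w
  exact Nat.sInf_mem (s := {k | ∃ l : List G, (∀ t ∈ l, IsReflectionOf S t) ∧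
    l.length = k ∧ l.prod = w}) ⟨_, l, hl, rfl, hw⟩

theorem absLength_mul_le
    (hgen : ∀ w : G, ∃ l : List G, (∀ t ∈ l, IsReflectionOf S t) ∧ l.prod = w) (u v : G) :
    absLength S (u * v) ≤ absLength S u + absLength S v := by
  obtain ⟨l, hl, hl', rfl⟩ := exists_absLength_word hgen u
  obtain ⟨m, hm, hm', rfl⟩ := exists_absLength_word hgen v
  rw [← hl', ← hm', ← List.prod_append, ← List.length_append]
  refine absLength_prod_le fun t ht => ?_
  rcases List.mem_append.1 ht with h | h
  exacts [hl t h, hm t h]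

theorem IsReflectionOf.absLength_le_one {t : G} (ht : IsReflectionOf S t) :
    absLength S t ≤ 1 := by
  have := absLength_prod_le (S := S) (l := [t]) (by simpa using ht)
  simpa using this

theorem isReflectionOf_of_absLength_eq_one
    (hgen : ∀ w : G, ∃ l : List G, (∀ t ∈ l, IsReflectionOf S t) ∧ l.prod = w) {w : G}
    (hw : absLength S w = 1) : IsReflectionOf S w := by
  obtain ⟨l, hl, hl', rfl⟩ := exists_absLength_word hgen w
  rw [hw, List.length_eq_one_iff] at hl'
  obtain ⟨t, rfl⟩ := hl'
  simpa using hl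

theorem absLength_conj_le
    (hgen : ∀ w : G, ∃ l : List G, (∀ t ∈ l, IsReflectionOf S t) ∧ l.prod = w) (g w : G) :
    absLength S (g * w * g⁻¹) ≤ absLength S w := by
  obtain ⟨l, hl, hl', rfl⟩ := exists_absLength_word hgen w
  rw [← hl', ← MulAut.conj_apply, map_list_prod, ← List.length_map (MulAut.conj g)]
  refine absLength_prod_le fun t ht => ?_
  obtain ⟨r, hr, rfl⟩ := List.mem_map.1 ht
  exact (hl r hr).conj g

theorem absLength_conj
    (hgen : ∀ w : G, ∃ l : List G, (∀ t ∈ l, IsReflectionOf S t) ∧ l.prod = w) (g w : G) :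
    absLength S (g * w * g⁻¹) = absLength S w := by
  refine le_antisymm (absLength_conj_le hgen g w) ?_
  have := absLength_conj_le hgen g⁻¹ (g * w * g⁻¹)
  have e : g⁻¹ * (g * w * g⁻¹) * g⁻¹⁻¹ = w := by group
  rwa [e] at this

theorem scCount_conj
    (hgen : ∀ w : G, ∃ l : List G, (∀ t ∈ l, IsReflectionOf S t) ∧ l.prod = w) (g c : G) (k : ℕ) :
    scCount S (g * c * g⁻¹) k = scCount S c k := by
  have hle (u v : G) : absLe S (g * u * g⁻¹) (g * v * g⁻¹) ↔ absLe S u v := by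
    have e : (g * u * g⁻¹)⁻¹ * (g * v * g⁻¹) = g * (u⁻¹ * v) * g⁻¹ := by group
    rw [absLe, absLe, e, absLength_conj hgen, absLength_conj hgen, absLength_conj hgen]
  refine (Nat.card_congr (Equiv.subtypeEquiv
    (Equiv.piCongrRight fun _ => (MulAut.conj g).toEquiv) fun y => ?_)).symm
  simp [hle, absLength_conj hgen]

/-- Deleting the first step of a saturated chain. -/
theorem scCount_succ [Fintype G]
    (hgen : ∀ w : G, ∃ l : List G, (∀ t ∈ l, IsReflectionOf S t) ∧ l.prod = w)
    (hinv : ∀ s ∈ S, s * s = 1) {c : G}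
    (hc : ∀ t, IsReflectionOf S t → absLength S (t * c) + 1 = absLength S c)
    (T : Finset G) (hT : ∀ t, t ∈ T ↔ IsReflectionOf S t) (k : ℕ) :
    scCount S c (k + 1) = ∑ t ∈ T, scCount S (t * c) k := by
  classical
  let Q : G → (Fin (k + 1) → G) → Prop := fun t z => (∀ i, absLe S (z i) (t * c)) ∧
    (∀ i : Fin k, absLe S (z i.castSucc) (z i.succ)) ∧
    (∀ i : Fin k, absLength S (z i.succ) = absLength S (z i.castSucc) + 1)
  have hmul := absLength_mul_le hgen
  have e1 : scCount S c (k + 1) =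
      Nat.card {p : G × (Fin (k + 1) → G) // IsReflectionOf S p.1 ∧ Q p.1 p.2} := by
    refine Nat.card_congr
      { toFun := fun y => ⟨(y.1 1 * (y.1 0)⁻¹, fun i => (y.1 1 * (y.1 0)⁻¹)⁻¹ * y.1 i.succ), ?_⟩
        invFun := fun p => ⟨Fin.cons (p.1.2 0) fun i => p.1.1 * p.1.2 i, ?_⟩
        left_inv := ?_
        right_inv := ?_ }
    · obtain ⟨y, h1, h2, h3⟩ := y
      dsimp only
      have h4 := h2 0
      have h5 := h3 0
      simp only [Fin.castSucc_zero, Fin.succ_zero_eq_one, absLe] at h4 h5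
      have ht0 : IsReflectionOf S ((y 0)⁻¹ * y 1) :=
        isReflectionOf_of_absLength_eq_one hgen (by omega)
      have ht : IsReflectionOf S (y 1 * (y 0)⁻¹) := by
        have := ht0.conj (y 0)
        simpa [mul_assoc] using this
      set t := y 1 * (y 0)⁻¹ with ht'
      have htt := ht.mul_self hinv
      have htinv : t⁻¹ = t := inv_eq_of_mul_eq_one_left htt
      have hlow (i : Fin (k + 1)) : absLength S (y i.succ) ≤ absLength S (t⁻¹ * y i.succ) + 1 := by
        have := hmul t (t⁻¹ * y i.succ)
        rw [mul_inv_cancel_left] at this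
        have := ht.absLength_le_one
        omega
      have hstep (i : Fin k) : (t⁻¹ * y i.castSucc.succ)⁻¹ * (t⁻¹ * y i.succ.succ) =
          (y i.castSucc.succ)⁻¹ * y i.succ.succ := by group
      have hup (i : Fin (k + 1)) : absLength S (t⁻¹ * y i.succ) + 1 = absLength S (y i.succ) := by
        refine le_antisymm ?_ (hlow i)
        induction i using Fin.induction with
        | zero =>
          have : t⁻¹ * y (Fin.succ 0) = y 0 := by simp [ht']
          rw [this, Fin.succ_zero_eq_one]
          exact h5.ge
        | succ i ih =>
          have h6 := hmul (t⁻¹ * y i.castSucc.succ)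
            ((t⁻¹ * y i.castSucc.succ)⁻¹ * (t⁻¹ * y i.succ.succ))
          rw [hstep, ← hstep, mul_inv_cancel_left, hstep] at h6
          have h7 := h2 i.succ
          have h8 := h3 i.succ
          simp only [absLe, ← Fin.succ_castSucc] at h7 h8
          omega
      refine ⟨ht, fun i => ?_, fun i => ?_, fun i => ?_⟩
      · have h6 := h1 i.succ
        have h7 := hc t ht
        have h8 := hup i
        have e : (t⁻¹ * y i.succ)⁻¹ * (t * c) = (y i.succ)⁻¹ * c := by
          rw [mul_inv_rev, inv_inv, mul_assoc, ← mul_assoc t, htt, one_mul]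
        simp only [absLe] at h6 ⊢
        rw [e]
        omega
      · have h6 := hup i.castSucc
        have h7 := hup i.succ
        have h8 := h2 i.succ
        simp only [absLe, ← Fin.succ_castSucc] at h8 ⊢
        rw [hstep]
        omega
      · have h6 := hup i.castSucc
        have h7 := hup i.succ
        have h8 := h3 i.succ
        simp only [← Fin.succ_castSucc] at h8 ⊢
        omega
    · obtain ⟨⟨t, z⟩, ht, h1, h2, h3⟩ := p
      dsimp only at ht h1 h2 h3 ⊢
      have htt := ht.mul_self hinv
      have ht1 := ht.absLength_le_one
      have h4 := hc t ht
      have e (i) : (t * z i)⁻¹ * c = (z i)⁻¹ * (t * c) := by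
        rw [mul_inv_rev, inv_eq_of_mul_eq_one_left htt, mul_assoc]
      have hlen (i) : absLength S (t * z i) = absLength S (z i) + 1 := by
        have h5 := hmul t (z i)
        have h6 := hmul (t * z i) ((t * z i)⁻¹ * c)
        have h7 := h1 i
        rw [mul_inv_cancel_left, e] at h6
        rw [absLe] at h7
        omega
      have ht0 : IsReflectionOf S ((z 0)⁻¹ * t * z 0) := by simpa using ht.conj (z 0)⁻¹
      refine ⟨fun i => ?_, fun i => ?_, fun i => ?_⟩
      · cases i using Fin.cases with
        | zero =>
          have h5 := h1 0
          have h6 := hmul ((z 0)⁻¹ * t * z 0) ((z 0)⁻¹ * (t * c))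
          have h7 := ht0.absLength_le_one
          have h8 := hmul (z 0) ((z 0)⁻¹ * c)
          have e' : (z 0)⁻¹ * t * z 0 * ((z 0)⁻¹ * (t * c)) = (z 0)⁻¹ * c := by
            have : (z 0)⁻¹ * t * z 0 * ((z 0)⁻¹ * (t * c)) = (z 0)⁻¹ * (t * t) * c := by group
            rw [this, htt, mul_one]
          rw [e'] at h6
          rw [mul_inv_cancel_left] at h8
          simp only [absLe, Fin.cons_zero] at h5 ⊢
          omega
        | succ i =>
          have h5 := h1 i
          simp only [absLe, Fin.cons_succ] at h5 ⊢
          rw [e, hlen]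
          omega
      · cases i using Fin.cases with
        | zero =>
          have h7 := ht0.absLength_le_one
          have h8 := hmul (z 0) ((z 0)⁻¹ * (t * z 0))
          rw [mul_inv_cancel_left] at h8
          have h9 := hlen 0
          simp only [absLe, Fin.castSucc_zero, Fin.cons_zero, Fin.cons_succ, mul_assoc] at h7 h8 ⊢
          omega
        | succ i =>
          have h5 := h2 i
          have e' : (t * z i.castSucc)⁻¹ * (t * z i.succ) = (z i.castSucc)⁻¹ * z i.succ := by group
          simp only [absLe, ← Fin.succ_castSucc, Fin.cons_succ] at h5 ⊢
          rw [e', hlen, hlen]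
          omega
      · cases i using Fin.cases with
        | zero => simpa using hlen 0
        | succ i =>
          have h5 := h3 i
          simp only [← Fin.succ_castSucc, Fin.cons_succ] at h5 ⊢
          rw [hlen, hlen, h5]
    · rintro ⟨y, hy⟩
      refine Subtype.ext (funext fun i => ?_)
      cases i using Fin.cases with
      | zero => simp
      | succ i => simp only [Fin.cons_succ, mul_inv_cancel_left]
    · rintro ⟨⟨t, z⟩, hz⟩
      have h1 : (Fin.cons (z 0) fun i => t * z i : Fin (k + 1 + 1) → G) 1 = t * z 0 := rfl
      refine Subtype.ext (Prod.ext ?_ (funext fun i => ?_))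
      · simp [h1]
      · simp [h1]
  rw [e1, Nat.card_congr (Equiv.subtypeProdEquivSigmaSubtype
    fun t (z : Fin (k + 1) → G) => IsReflectionOf S t ∧ Q t z), Nat.card_sigma,
    ← Finset.sum_subset (Finset.subset_univ T)]
  · refine Finset.sum_congr rfl fun t ht => ?_
    rw [hT] at ht
    simp only [ht, true_and]
    rfl
  · intro t _ ht
    rw [hT] at ht
    simp [ht]

end AbsLength

section CoxeterWords

variable {G : Type*} [Group G]

/-- The equivalence of words generated by exchanging adjacent commuting letters and by cyclic
rotation. -/
inductive RotationEquiv : List G → List G → Prop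
  | swap (x y : List G) {a b : G} (h : Commute a b) :
      RotationEquiv (x ++ a :: b :: y) (x ++ b :: a :: y)
  | rotate (a : G) (v : List G) : RotationEquiv (a :: v) (v ++ [a])
  | refl (u : List G) : RotationEquiv u u
  | symm {u v : List G} : RotationEquiv u v → RotationEquiv v u
  | trans {u v w : List G} : RotationEquiv u v → RotationEquiv v w → RotationEquiv u w

namespace RotationEquiv

theorem perm {u v : List G} (h : RotationEquiv u v) : u.Perm v := by
  induction h with
  | swap x y h => exact (List.Perm.swap _ _ _).append_left x
  | rotate a v => exact (List.perm_append_singleton a v).symm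
  | refl u => exact List.Perm.refl u
  | symm _ ih => exact ih.symm
  | trans _ _ ih₁ ih₂ => exact ih₁.trans ih₂

theorem isConj_prod {u v : List G} (h : RotationEquiv u v) : IsConj u.prod v.prod := by
  induction h with
  | swap x y h =>
    simp only [List.prod_append, List.prod_cons, ← mul_assoc]
    rw [mul_assoc x.prod, h.eq, ← mul_assoc]
  | rotate a v => exact isConj_iff.2 ⟨a⁻¹, by simp⟩
  | refl u => exact IsConj.refl _
  | symm _ ih => exact ih.symm
  | trans _ _ ih₁ ih₂ => exact ih₁.trans ih₂

theorem append_comm (u v : List G) : RotationEquiv (u ++ v) (v ++ u) := by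
  induction u generalizing v with
  | nil => simpa using refl v
  | cons a u ih =>
    have h1 := rotate a (u ++ v)
    have h2 := ih (v ++ [a])
    simp only [List.append_assoc, List.cons_append, List.nil_append] at h1 h2 ⊢
    exact h1.trans h2

theorem move_past (x : List G) {s : G} {v : List G} (h : ∀ b ∈ v, Commute s b) :
    RotationEquiv (x ++ s :: v) (x ++ v ++ [s]) := by
  induction v generalizing x with
  | nil => simpa using refl _
  | cons a v ih =>
    have h1 := swap x v (h a (by simp))
    have h2 := ih (x ++ [a]) fun b hb => h b (by simp [hb])
    simp only [List.append_assoc, List.cons_append, List.nil_append] at h1 h2 ⊢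
    exact h1.trans h2

/-- An equivalence of words extends along a letter with at most one noncommuting neighbour. -/
theorem cons {s : G} {u v : List G} (h : RotationEquiv u v) (hu : u.Nodup)
    (hs : ∀ b ∈ u, ∀ b' ∈ u, ¬ Commute s b → ¬ Commute s b' → b = b') :
    RotationEquiv (s :: u) (s :: v) := by
  induction h with
  | swap x y h => exact swap (s :: x) y h
  | rotate a v =>
    by_cases ha : Commute s a
    · exact (swap [] v ha).trans (rotate a (s :: v))
    · have hv : ∀ b ∈ v, Commute s b := by
        intro b hb
        by_contra hsb
        have := hs b (by simp [hb]) a (by simp) hsb ha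
        exact (List.nodup_cons.1 hu).1 (this ▸ hb)
      exact ((rotate s (a :: v)).trans (move_past [a] hv).symm).trans (rotate a (s :: v))
  | refl u => exact refl _
  | symm h ih =>
    have hp := h.perm
    exact (ih (hp.nodup_iff.2 hu) fun b hb b' hb' =>
      hs b (hp.mem_iff.1 hb) b' (hp.mem_iff.1 hb')).symm
  | trans h _ ih₁ ih₂ =>
    have hp := h.perm
    exact (ih₁ hu hs).trans (ih₂ (hp.nodup_iff.1 hu) fun b hb b' hb' =>
      hs b (hp.mem_iff.2 hb) b' (hp.mem_iff.2 hb'))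

/-- Words on the vertices of a forest which are permutations of one another are equivalent. -/
theorem of_perm {u v : List G} (hu : u.Nodup) (huv : u.Perm v)
    (hforest : ∀ J : Finset G, J.Nonempty → (∀ x ∈ J, x ∈ u) →
      ∃ a ∈ J, ∀ b ∈ J, ∀ b' ∈ J, ¬ Commute a b → ¬ Commute a b' → b = b') :
    RotationEquiv u v := by
  classical
  induction hn : u.length generalizing u v with
  | zero =>
    rw [List.length_eq_zero_iff] at hn
    subst hn
    rw [List.nil_perm.1 huv]
    exact refl _
  | succ n ih =>
    obtain ⟨s, hs, hleaf⟩ := hforest u.toFinset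
      (by
        rw [List.toFinset_nonempty_iff]
        rintro rfl
        simp at hn)
      (fun x hx => List.mem_toFinset.1 hx)
    rw [List.mem_toFinset] at hs
    obtain ⟨x, y, rfl⟩ := List.append_of_mem hs
    obtain ⟨x', y', rfl⟩ := List.append_of_mem (huv.mem_iff.1 hs)
    have h1 := append_comm x (s :: y)
    have h2 := append_comm x' (s :: y')
    simp only [List.cons_append] at h1 h2
    have hp : (y ++ x).Perm (y' ++ x') :=
      (List.perm_cons s).1 ((h1.perm.symm.trans huv).trans h2.perm)
    have hd := List.nodup_cons.1 (h1.perm.nodup_iff.1 hu)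
    have hmem (b : G) (hb : b ∈ y ++ x) : b ∈ x ++ s :: y := by
      rw [h1.perm.mem_iff]
      exact List.mem_cons_of_mem s hb
    have h3 : RotationEquiv (y ++ x) (y' ++ x') := by
      refine ih hd.2 hp (fun J hJ hJ' => hforest J hJ fun b hb => hmem b (hJ' b hb)) ?_
      simp only [List.length_append, List.length_cons] at hn ⊢
      omega
    refine (h1.trans (h3.cons hd.2 fun b hb b' hb' => ?_)).trans h2.symm
    exact hleaf b (List.mem_toFinset.2 (hmem b hb)) b' (List.mem_toFinset.2 (hmem b' hb'))

end RotationEquiv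

end CoxeterWords

theorem List.nodup_append_and_mem_iff_ne {α : Type*} {l₁ l₂ : List α} {i : α}
    (hl : (l₁ ++ i :: l₂).Nodup)
    (hall : ∀ j, j ∈ l₁ ++ i :: l₂) :
    (l₁ ++ l₂).Nodup ∧ ∀ j, j ∈ l₁ ++ l₂ ↔ j ≠ i := by
  have hp : (l₁ ++ i :: l₂).Perm (i :: (l₁ ++ l₂)) := List.perm_middle
  have h1 := List.nodup_cons.1 (hp.nodup_iff.1 hl)
  refine ⟨h1.2, fun j => ⟨fun hj hji => h1.1 (hji ▸ hj), fun hj => ?_⟩⟩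
  exact (List.mem_cons.1 (hp.mem_iff.1 (hall j))).resolve_left hj

namespace CoxeterSystem

variable {B : Type*} [Fintype B] [DecidableEq B] {W : Type*} [Group W] {M : CoxeterMatrix B}
  (cs : CoxeterSystem M W) [Finite W]

/-- The Coxeter graph of a finite Coxeter group is a forest. -/
theorem exists_leaf {J : Finset B} (hJ : J.Nonempty) :
    ∃ a ∈ J, ∀ b ∈ J, ∀ b' ∈ J, ¬ Commute (cs.simple a) (cs.simple b) →
      ¬ Commute (cs.simple a) (cs.simple b') → b = b' := by
  by_contra! hcon
  set x : B → ℝ := ∑ j ∈ J, Pi.single j 1 with hx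
  have hxa (a : B) : x a = if a ∈ J then 1 else 0 := by
    simp [hx, Finset.sum_apply, Pi.single_apply]
  obtain ⟨a₀, ha₀⟩ := hJ
  have hx0 : x ≠ 0 := by
    intro h
    have := congrFun h a₀
    simp [hxa, ha₀] at this
  have hle (a : B) (ha : a ∈ J) : M.cosForm (Pi.single a 1) x ≤ 0 := by
    obtain ⟨b, hb, b', hb', hab, hab', hne⟩ := hcon a ha
    have hba : b ≠ a := by rintro rfl; exact hab (Commute.refl _)
    have hba' : b' ≠ a := by rintro rfl; exact hab' (Commute.refl _)
    have h1 : b ∈ J.erase a := Finset.mem_erase.2 ⟨hba, hb⟩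
    have h2 : b' ∈ (J.erase a).erase b :=
      Finset.mem_erase.2 ⟨hne.symm, Finset.mem_erase.2 ⟨hba', hb'⟩⟩
    rw [hx, map_sum, ← Finset.add_sum_erase _ _ ha, ← Finset.add_sum_erase _ _ h1,
      ← Finset.add_sum_erase _ _ h2, M.cosForm_single_self]
    have h3 := cs.cosForm_single_le_of_not_commute hab
    have h4 := cs.cosForm_single_le_of_not_commute hab'
    have h5 : ∑ j ∈ ((J.erase a).erase b).erase b', M.cosForm (Pi.single a 1) (Pi.single j 1) ≤ 0 :=
      Finset.sum_nonpos fun j hj => M.cosForm_single_nonpos (by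
        simp only [Finset.mem_erase] at hj
        exact hj.2.2.1.symm)
    linarith
  have hpos := cs.cosForm_self_pos hx0
  have : M.cosForm x x ≤ 0 := by
    nth_rewrite 2 [hx]
    rw [map_sum]
    exact Finset.sum_nonpos fun a ha => M.cosForm_comm x _ ▸ hle a ha
  linarith

omit [Finite W] in
/-- Fewer reflections than the rank have a common fixed vector. -/
theorem exists_fixed_of_length_lt {l : List W} (hl : ∀ t ∈ l, IsReflectionOf (simpleSet cs) t)
    (hlen : l.length < Fintype.card B) :
    ∃ x : B → ℝ, x ≠ 0 ∧ ∀ t ∈ l, cs.geomRep t x = x := by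
  have hroot (j : Fin l.length) : ∃ w i, l.get j = w * cs.simple i * w⁻¹ := by
    obtain ⟨w, _, ⟨i, rfl⟩, h⟩ := hl _ (l.get_mem j)
    exact ⟨w, i, h⟩
  choose w i hwi using hroot
  let φ : (B → ℝ) →ₗ[ℝ] (Fin l.length → ℝ) :=
    LinearMap.pi fun j => M.cosForm (cs.geomRep (w j) (Pi.single (i j) 1))
  have hker : φ.ker ≠ ⊥ := LinearMap.ker_ne_bot_of_finrank_lt (by simpa using hlen)
  obtain ⟨x, hx, hx0⟩ := Submodule.exists_mem_ne_zero_of_ne_bot hker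
  refine ⟨x, hx0, fun t ht => ?_⟩
  obtain ⟨j, rfl⟩ := List.get_of_mem ht
  have hj : M.cosForm (cs.geomRep (w j) (Pi.single (i j) 1)) x = 0 :=
    congrFun (LinearMap.mem_ker.1 hx) j
  rw [hwi j, geomRep_conj_simple, hj]
  simp

omit [Finite W] in
theorem geomRep_prod_apply_of_fixed {l : List W} {x : B → ℝ} (h : ∀ t ∈ l, cs.geomRep t x = x) :
    cs.geomRep l.prod x = x := by
  induction l with
  | nil => simp
  | cons t l ih =>
    rw [List.prod_cons, geomRep_mul_apply, ih fun r hr => h r (List.mem_cons_of_mem t hr),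
      h t List.mem_cons_self]

omit [Fintype B] [DecidableEq B] [Finite W] in
theorem exists_reflection_word (w : W) :
    ∃ l : List W, (∀ t ∈ l, IsReflectionOf (simpleSet cs) t) ∧ l.prod = w :=
  exists_reflection_word_of_closure_eq_top cs.subgroup_closure_range_simple
    (by rintro _ ⟨i, rfl⟩; exact cs.simple_mul_simple_self i) w

omit [Fintype B] [DecidableEq B] [Finite W] in
theorem absLength_wordProd_le (l : List B) :
    absLength (simpleSet cs) (cs.wordProd l) ≤ l.length := by
  rw [← List.length_map cs.simple, wordProd]
  refine absLength_prod_le fun t ht => ?_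
  obtain ⟨i, -, rfl⟩ := List.mem_map.1 ht
  exact ⟨1, _, ⟨i, rfl⟩, by simp⟩

theorem absLength_coxeter {l : List B} (hl : l.Nodup) (hall : ∀ i, i ∈ l) :
    absLength (simpleSet cs) (cs.wordProd l) = Fintype.card B := by
  have hcard : l.length = Fintype.card B := by
    rw [← List.toFinset_card_of_nodup hl, ← Finset.card_univ]
    congr 1
    ext i
    simp [hall i]
  refine le_antisymm (hcard ▸ cs.absLength_wordProd_le l) ?_
  by_contra! hlt
  obtain ⟨m, hm, hm', hprod⟩ := exists_absLength_word cs.exists_reflection_word (cs.wordProd l)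
  obtain ⟨x, hx, hfix⟩ := cs.exists_fixed_of_length_lt hm (hm' ▸ hlt)
  refine hx (cs.eq_zero_of_geomRep_wordProd_eq_self hl hall ?_)
  rw [← hprod]
  exact cs.geomRep_prod_apply_of_fixed hfix

theorem absLength_parabolic_coxeter {s : B} {l : List B} (hl : l.Nodup) (hs : ∀ i, i ∈ l ↔ i ≠ s) :
    absLength (simpleSet cs) (cs.wordProd l) + 1 = Fintype.card B ∧
      l.length + 1 = Fintype.card B := by
  have hl' : (s :: l).Nodup := List.nodup_cons.2 ⟨fun h => (hs s).1 h rfl, hl⟩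
  have hall (i : B) : i ∈ s :: l := by
    rw [List.mem_cons, hs]
    exact em _
  have h1 := cs.absLength_coxeter hl' hall
  have hcard : (s :: l).length = Fintype.card B := by
    rw [← List.toFinset_card_of_nodup hl', ← Finset.card_univ]
    congr 1
    ext i
    simp only [List.mem_toFinset, hall i, Finset.mem_univ]
  rw [List.length_cons] at hcard
  have h2 := cs.absLength_wordProd_le l
  have h3 := absLength_mul_le cs.exists_reflection_word (cs.simple s) (cs.wordProd l)
  have h4 : absLength (simpleSet cs) (cs.simple s) ≤ 1 := by
    simpa using cs.absLength_wordProd_le [s]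
  rw [wordProd_cons] at h1
  omega

omit [Fintype B] [DecidableEq B] [Finite W] in
theorem leftInversion_mul_wordProd (l₁ l₂ : List B) (i : B) :
    cs.wordProd l₁ * cs.simple i * (cs.wordProd l₁)⁻¹ * cs.wordProd (l₁ ++ i :: l₂) =
      cs.wordProd (l₁ ++ l₂) := by
  simp [wordProd_append, wordProd_cons, mul_assoc]

theorem absLength_reflection_mul_coxeter {l : List B} (hl : l.Nodup) (hall : ∀ i, i ∈ l) {t : W}
    (ht : IsReflectionOf (simpleSet cs) t) :
    absLength (simpleSet cs) (t * cs.wordProd l) + 1 =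
      absLength (simpleSet cs) (cs.wordProd l) := by
  obtain ⟨w, _, ⟨i, rfl⟩, rfl⟩ := ht
  obtain ⟨n, -, l₁, k, l₂, hlk, h⟩ := cs.exists_pow_geomRep_eq hl hall w i
  rw [(cs.conj_simple_eq_iff w _ i k).2 (Or.inl h), cs.absLength_coxeter hl hall]
  have h1 := cs.leftInversion_mul_wordProd l₁ l₂ k
  rw [← hlk] at h1
  set c := cs.wordProd l
  have e : c ^ n * cs.wordProd l₁ * cs.simple k * (c ^ n * cs.wordProd l₁)⁻¹ * c =
      c ^ n * (cs.wordProd l₁ * cs.simple k * (cs.wordProd l₁)⁻¹ * c) * (c ^ n)⁻¹ := by group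
  rw [e, absLength_conj cs.exists_reflection_word, h1]
  subst hlk
  obtain ⟨h2, h3⟩ := List.nodup_append_and_mem_iff_ne hl hall
  exact (cs.absLength_parabolic_coxeter h2 h3).1

end CoxeterSystem

namespace CoxeterSystem

variable {B : Type*} [Fintype B] [DecidableEq B] {W : Type*} [Group W] {M : CoxeterMatrix B}
  (cs : CoxeterSystem M W) [Finite W]

omit [Fintype B] [DecidableEq B] [Finite W] in
theorem simple_mem_parabolic {s k : B} (h : cs.simple k ≠ cs.simple s) :
    cs.simple k ∈ parabolic cs s :=
  Subgroup.subset_closure ⟨⟨k, rfl⟩, h⟩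

/-- A reflection whose root has no component along `s` is a reflection of the parabolic subgroup
omitting `s`. -/
theorem exists_mem_parabolic_conj {s : B} (w : W) (i : B)
    (h : cs.geomRep w (Pi.single i 1) s = 0) :
    ∃ g ∈ parabolic cs s, ∃ k, k ≠ s ∧ w * cs.simple i * w⁻¹ = g * cs.simple k * g⁻¹ := by
  classical
  wlog hpos : 0 ≤ cs.geomRep w (Pi.single i 1) generalizing w
  · have hneg := (cs.geomRep_single_nonneg_or_nonpos w i).resolve_left hpos
    have e : w * cs.simple i * w⁻¹ = w * cs.simple i * cs.simple i * (w * cs.simple i)⁻¹ := by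
      simp [mul_assoc]
    rw [e]
    have h1 : cs.geomRep (w * cs.simple i) (Pi.single i 1) =
        -cs.geomRep w (Pi.single i 1) := by
      rw [geomRep_mul_apply, geomRep_simple_single, map_neg]
    refine this _ ?_ ?_
    · rw [h1, Pi.neg_apply, h, neg_zero]
    · rw [h1]
      exact neg_nonneg.2 hneg
  by_contra hcon
  let A : Set (W × B) := {p | 0 ≤ cs.geomRep p.1 (Pi.single p.2 1) ∧
    cs.geomRep p.1 (Pi.single p.2 1) s = 0 ∧
    ¬ ∃ g ∈ parabolic cs s, ∃ k, k ≠ s ∧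
      p.1 * cs.simple p.2 * p.1⁻¹ = g * cs.simple k * g⁻¹}
  obtain ⟨⟨w, i⟩, ⟨hpos, h, hcon⟩, hmin⟩ := Set.exists_min_image A
    (fun p => ∑ j, cs.geomRep p.1 (Pi.single p.2 1) j) (Set.toFinite A) ⟨(w, i), hpos, h, hcon⟩
  dsimp only at hpos h hcon hmin
  set β := cs.geomRep w (Pi.single i 1) with hβ
  have hone : M.cosForm β β = 1 := by rw [hβ, cosForm_geomRep, M.cosForm_single_self]
  obtain ⟨k, -, hk⟩ : ∃ k ∈ Finset.univ, 0 < β k * M.cosForm (Pi.single k 1) β := by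
    by_contra! hle
    have := Finset.sum_nonpos hle
    rw [← CoxeterSystem.cosForm_eq_sum, hone] at this
    linarith
  have hβk : 0 < β k := (hpos k).lt_of_ne fun h0 => by simp [← h0] at hk
  have hBk : 0 < M.cosForm (Pi.single k 1) β := (pos_iff_pos_of_mul_pos hk).1 hβk
  have hks : k ≠ s := by
    rintro rfl
    exact hβk.ne' h
  have hkP := cs.simple_mem_parabolic (fun h => hks (cs.simple_injective h))
  have hstep : cs.geomRep (cs.simple k * w) (Pi.single i 1) =
      β - (2 * M.cosForm (Pi.single k 1) β) • Pi.single k 1 := by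
    rw [geomRep_mul_apply, geomRep_simple]
  rcases cs.geomRep_single_nonneg_or_nonpos (cs.simple k * w) i with h1 | h1
  · have h2 : (cs.simple k * w, i) ∉ A := fun hA => by
      have := hmin _ hA
      dsimp only at this
      rw [hstep] at this
      simp only [Pi.sub_apply, Pi.smul_apply, smul_eq_mul, Finset.sum_sub_distrib,
        ← Finset.mul_sum, Finset.sum_pi_single', Finset.mem_univ, if_true] at this
      linarith
    refine h2 ⟨h1, ?_, ?_⟩
    · dsimp only
      rw [hstep]
      simp [h, hks.symm]
    · rintro ⟨g, hg, m, hm, hgm⟩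
      refine hcon ⟨cs.simple k * g, mul_mem hkP hg, m, hm, ?_⟩
      dsimp only at hgm
      have e : w * cs.simple i * w⁻¹ = (cs.simple k)⁻¹ *
          (cs.simple k * w * cs.simple i * (cs.simple k * w)⁻¹) * cs.simple k := by group
      rw [e, hgm]
      simp [mul_assoc]
  · have h2 := cs.geomRep_single_eq_of_nonpos w i k hpos h1
    refine hcon ⟨1, one_mem _, k, hks, ?_⟩
    refine (cs.conj_simple_eq_iff w 1 i k).2 (Or.inl ?_)
    simpa using h2

theorem isReflectionOf_parabolicGens {s : B} {t : W} (ht : IsReflectionOf (simpleSet cs) t)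
    (h : cs.geomRep t (cs.weight s) = cs.weight s) :
    ∃ r : parabolic cs s, IsReflectionOf (parabolicGens cs s) r ∧ (r : W) = t := by
  obtain ⟨w, _, ⟨i, rfl⟩, rfl⟩ := ht
  rw [geomRep_conj_simple, cosForm_weight, sub_eq_self] at h
  have h1 : cs.geomRep w (Pi.single i 1) s = 0 := by
    rcases smul_eq_zero.1 h with h2 | h2
    · linarith
    · exact absurd h2 (cs.geomRep_single_ne_zero w i)
  obtain ⟨g, hg, k, hk, e⟩ := cs.exists_mem_parabolic_conj w i h1
  have hks : cs.simple k ≠ cs.simple s := fun h => hk (cs.simple_injective h)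
  refine ⟨⟨g, hg⟩ * ⟨cs.simple k, cs.simple_mem_parabolic hks⟩ * ⟨g, hg⟩⁻¹,
    ⟨⟨g, hg⟩, ⟨cs.simple k, cs.simple_mem_parabolic hks⟩, ⟨⟨k, rfl⟩, hks⟩, rfl⟩, ?_⟩
  rw [e]
  rfl

/-- Every letter of a shortest word in reflections of a parabolic Coxeter element lies in the
parabolic subgroup. -/
theorem geomRep_weight_of_mem_word {s : B} {l : List B} (hl : l.Nodup) (hs : ∀ i, i ∈ l ↔ i ≠ s)
    {m : List W} (hm : ∀ t ∈ m, IsReflectionOf (simpleSet cs) t)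
    (hlen : m.length + 1 = Fintype.card B) (hprod : m.prod = cs.wordProd l) {t : W} (ht : t ∈ m) :
    cs.geomRep t (cs.weight s) = cs.weight s := by
  obtain ⟨y, hy, hfix⟩ := cs.exists_fixed_of_length_lt hm (by omega)
  have hly := cs.geomRep_prod_apply_of_fixed hfix
  rw [hprod] at hly
  have hy' : y = M.cosForm (Pi.single s 1) y • cs.weight s := by
    conv_lhs => rw [cs.eq_sum_smul_weight y]
    refine Finset.sum_eq_single s (fun k _ hk => ?_) (by simp)
    rw [cs.cosForm_eq_zero_of_fixed l hl y hly k ((hs k).2 hk), zero_smul]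
  have hne : M.cosForm (Pi.single s 1) y ≠ 0 := fun h => hy (by rw [hy', h, zero_smul])
  have h1 := hfix t ht
  rw [hy', map_smul] at h1
  exact smul_right_injective _ hne h1

omit [Fintype B] [DecidableEq B] [Finite W] in
theorem exists_reflection_word_parabolic {s : B} (w : parabolic cs s) :
    ∃ l : List (parabolic cs s), (∀ t ∈ l, IsReflectionOf (parabolicGens cs s) t) ∧ l.prod = w := by
  refine exists_reflection_word_of_closure_eq_top Subgroup.closure_closure_coe_preimage ?_ w
  rintro x ⟨⟨i, hi⟩, -⟩
  refine Subtype.ext ?_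
  rw [Subgroup.coe_mul, ← hi]
  exact cs.simple_mul_simple_self i

omit [Fintype B] [DecidableEq B] [Finite W] in
theorem isReflectionOf_coe {s : B} {t : parabolic cs s}
    (ht : IsReflectionOf (parabolicGens cs s) t) : IsReflectionOf (simpleSet cs) (t : W) := by
  obtain ⟨g, r, hr, rfl⟩ := ht
  exact ⟨g, r, hr.1, rfl⟩

omit [Fintype B] [DecidableEq B] [Finite W] in
theorem absLength_coe_le {s : B} (w : parabolic cs s) :
    absLength (simpleSet cs) (w : W) ≤ absLength (parabolicGens cs s) w := by
  obtain ⟨l, hl, hlen, rfl⟩ := exists_absLength_word cs.exists_reflection_word_parabolic w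
  rw [← hlen, ← Subgroup.coe_subtype, map_list_prod, ← List.length_map (parabolic cs s).subtype]
  refine absLength_prod_le fun t ht => ?_
  obtain ⟨r, hr, rfl⟩ := List.mem_map.1 ht
  exact cs.isReflectionOf_coe (hl r hr)

/-- The factors of a length-additive factorisation of a parabolic Coxeter element lie in the
parabolic subgroup, with the same absolute length. -/
theorem exists_parabolic_of_factorization {s : B} {l : List B} (hl : l.Nodup)
    (hs : ∀ i, i ∈ l ↔ i ≠ s) {u v w : W} (huvw : u * v * w = cs.wordProd l)
    (hlen : absLength (simpleSet cs) u + absLength (simpleSet cs) v + absLength (simpleSet cs) w =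
      absLength (simpleSet cs) (cs.wordProd l)) :
    ∃ z : parabolic cs s, (z : W) = v ∧
      absLength (parabolicGens cs s) z = absLength (simpleSet cs) v := by
  obtain ⟨a, ha, ha', rfl⟩ := exists_absLength_word cs.exists_reflection_word u
  obtain ⟨b, hb, hb', rfl⟩ := exists_absLength_word cs.exists_reflection_word v
  obtain ⟨d, hd, hd', rfl⟩ := exists_absLength_word cs.exists_reflection_word w
  have hm : ∀ t ∈ a ++ b ++ d, IsReflectionOf (simpleSet cs) t := by
    intro t ht
    simp only [List.mem_append] at ht
    rcases ht with (h | h) | h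
    exacts [ha t h, hb t h, hd t h]
  have hcard := (cs.absLength_parabolic_coxeter hl hs).1
  have hfix {t : W} (ht : t ∈ b) : cs.geomRep t (cs.weight s) = cs.weight s :=
    cs.geomRep_weight_of_mem_word hl hs hm (by simp only [List.length_append]; omega)
      (by simpa [mul_assoc] using huvw) (by simp [ht])
  have hlift : b ∈ Set.range (List.map
      fun r : {r : parabolic cs s // IsReflectionOf (parabolicGens cs s) r} => (r.1 : W)) := by
    rw [Set.range_list_map]
    intro t ht
    obtain ⟨r, hr, hrt⟩ := cs.isReflectionOf_parabolicGens (hb t ht) (hfix ht)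
    exact ⟨⟨r, hr⟩, hrt⟩
  obtain ⟨e, he⟩ := hlift
  have hprod : (((e.map Subtype.val).prod : parabolic cs s) : W) = b.prod := by
    rw [← he, ← Subgroup.coe_subtype, map_list_prod, List.map_map]
    rfl
  refine ⟨(e.map Subtype.val).prod, hprod, le_antisymm ?_ ?_⟩
  · rw [← hb', ← he, List.length_map, ← List.length_map Subtype.val]
    refine absLength_prod_le fun t ht => ?_
    obtain ⟨r, -, rfl⟩ := List.mem_map.1 ht
    exact r.2
  · rw [← hprod]
    exact cs.absLength_coe_le _

/-- Saturated chains below a parabolic Coxeter element may be counted in the parabolic subgroup. -/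
theorem scCount_parabolic {s : B} {l : List B} (hl : l.Nodup) (hs : ∀ i, i ∈ l ↔ i ≠ s)
    {x : parabolic cs s} (hx : (x : W) = cs.wordProd l) (k : ℕ) :
    scCount (simpleSet cs) (x : W) k = scCount (parabolicGens cs s) x k := by
  have hfac {u v w : W} (huvw : u * v * w = x) (hlen : absLength (simpleSet cs) u +
      absLength (simpleSet cs) v + absLength (simpleSet cs) w = absLength (simpleSet cs) (x : W))
      (z : parabolic cs s) (hz : (z : W) = v) :
      absLength (parabolicGens cs s) z = absLength (simpleSet cs) (z : W) := by
    rw [hx] at huvw hlen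
    obtain ⟨z', hz', h⟩ := cs.exists_parabolic_of_factorization hl hs huvw hlen
    obtain rfl : z = z' := Subtype.ext (hz.trans hz'.symm)
    rw [h, hz]
  have hone : absLength (simpleSet cs) (1 : W) = 0 := by
    simpa using cs.absLength_wordProd_le []
  have hxx := hfac (u := 1) (v := x) (w := 1) (by simp) (by simp [hone]) x rfl
  have hlow {z : parabolic cs s} (hz : absLe (simpleSet cs) (z : W) x) :
      absLength (parabolicGens cs s) z = absLength (simpleSet cs) (z : W) :=
    hfac (u := 1) (v := z) (w := (z : W)⁻¹ * x) (by group) (by rw [hone, zero_add]; exact hz) z rfl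
  have hmid {z w : parabolic cs s} (hzw : absLe (simpleSet cs) (z : W) w)
      (hw : absLe (simpleSet cs) (w : W) x) :
      absLength (parabolicGens cs s) (z⁻¹ * w) = absLength (simpleSet cs) ((z : W)⁻¹ * w) :=
    hfac (u := z) (v := (z : W)⁻¹ * w) (w := (w : W)⁻¹ * x) (by group)
      (by rw [absLe] at hzw hw; omega) (z⁻¹ * w) rfl
  have hle (z : parabolic cs s) : absLe (parabolicGens cs s) z x ↔ absLe (simpleSet cs) (z : W) x := by
    constructor
    · intro h
      have h1 := cs.absLength_coe_le z
      have h2 := cs.absLength_coe_le (z⁻¹ * x)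
      have h3 := absLength_mul_le cs.exists_reflection_word (z : W) ((z : W)⁻¹ * x)
      rw [mul_inv_cancel_left] at h3
      rw [Subgroup.coe_mul, Subgroup.coe_inv] at h2
      rw [absLe] at h ⊢
      omega
    · intro h
      have h1 := hlow h
      have h0 : absLe (simpleSet cs) (x : W) x := by simp [absLe, hone]
      have h2 := hmid h h0
      rw [absLe] at h ⊢
      omega
  have hle' (z w : parabolic cs s) (hz : absLe (simpleSet cs) (z : W) x)
      (hw : absLe (simpleSet cs) (w : W) x) :
      absLe (parabolicGens cs s) z w ↔ absLe (simpleSet cs) (z : W) w := by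
    have h1 := hlow hz
    have h2 := hlow hw
    constructor
    · intro h
      have h3 := cs.absLength_coe_le (z⁻¹ * w)
      have h4 := absLength_mul_le cs.exists_reflection_word (z : W) ((z : W)⁻¹ * w)
      rw [mul_inv_cancel_left] at h4
      rw [Subgroup.coe_mul, Subgroup.coe_inv] at h3
      rw [absLe] at h ⊢
      omega
    · intro h
      have h3 := hmid h hw
      rw [absLe] at h ⊢
      omega
  have hmem {z : W} (hz : absLe (simpleSet cs) z x) : ∃ z' : parabolic cs s, (z' : W) = z := by
    obtain ⟨z', hz', -⟩ := cs.exists_parabolic_of_factorization hl hs (u := 1) (v := z)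
      (w := z⁻¹ * x) (by rw [← hx]; group) (by rw [hone, zero_add, ← hx]; exact hz)
    exact ⟨z', hz'⟩
  symm
  refine Nat.card_congr (Equiv.ofBijective (fun y => ⟨fun i => (y.1 i : W), ?_⟩) ⟨?_, ?_⟩)
  · obtain ⟨y, h1, h2, h3⟩ := y
    have h1' (i) := (hle (y i)).1 (h1 i)
    refine ⟨h1', fun i => (hle' _ _ (h1' _) (h1' _)).1 (h2 i), fun i => ?_⟩
    dsimp only
    rw [← hlow (h1' _), ← hlow (h1' _)]
    exact h3 i
  · rintro ⟨y, hy⟩ ⟨y', hy'⟩ h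
    refine Subtype.ext (funext fun i => Subtype.ext ?_)
    exact congrFun (Subtype.ext_iff.1 h) i
  · rintro ⟨y, h1, h2, h3⟩
    choose y' hy' using fun i => hmem (h1 i)
    obtain rfl : (fun i => (y' i : W)) = y := funext hy'
    refine ⟨⟨y', fun i => (hle _).2 (h1 i), fun i => (hle' _ _ (h1 _) (h1 _)).2 (h2 i),
      fun i => ?_⟩, rfl⟩
    rw [hlow (h1 _), hlow (h1 _)]
    exact h3 i

end CoxeterSystem

namespace CoxeterSystem

variable {B : Type*} [Fintype B] [DecidableEq B] {W : Type*} [Group W] {M : CoxeterMatrix B}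
  (cs : CoxeterSystem M W) [Finite W]

/-- Any two Coxeter elements of a maximal parabolic subgroup are conjugate in it. -/
theorem isConj_of_isCoxeterElementOf {s : B} {x y : parabolic cs s}
    (hx : IsCoxeterElementOf (parabolicGens cs s) x)
    (hy : IsCoxeterElementOf (parabolicGens cs s) y) : IsConj x y := by
  classical
  obtain ⟨u, hu, hu', rfl⟩ := hx
  obtain ⟨v, hv, hv', rfl⟩ := hy
  have hp : u.Perm v := (List.perm_ext_iff_of_nodup hu hv).2 fun a => (hu' a).trans (hv' a).symm
  refine (RotationEquiv.of_perm hu hp fun J hJ hJu => ?_).isConj_prod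
  have hsimple (a) (ha : a ∈ J) : ∃ i, cs.simple i = (a : W) := ((hu' a).1 (hJu a ha)).1
  let J' : Finset B := {i | ∃ a ∈ J, cs.simple i = (a : W)}
  have hJ' : J'.Nonempty := by
    obtain ⟨a, ha⟩ := hJ
    obtain ⟨i, hi⟩ := hsimple a ha
    exact ⟨i, Finset.mem_filter.2 ⟨Finset.mem_univ _, a, ha, hi⟩⟩
  obtain ⟨i, hi, hleaf⟩ := cs.exists_leaf hJ'
  obtain ⟨a, ha, hia⟩ := (Finset.mem_filter.1 hi).2
  refine ⟨a, ha, fun b hb b' hb' hab hab' => ?_⟩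
  obtain ⟨k, hk⟩ := hsimple b hb
  obtain ⟨k', hk'⟩ := hsimple b' hb'
  have hcomm {b : parabolic cs s} (h : Commute (a : W) (b : W)) : Commute a b := Subtype.ext h
  have := hleaf k (Finset.mem_filter.2 ⟨Finset.mem_univ _, b, hb, hk⟩)
    k' (Finset.mem_filter.2 ⟨Finset.mem_univ _, b', hb', hk'⟩)
    (fun h => hab (hcomm (by rwa [← hia, ← hk])))
    (fun h => hab' (hcomm (by rwa [← hia, ← hk'])))
  exact Subtype.ext (by rw [← hk, ← hk', this])

omit [Finite W] in
theorem exists_isCoxeterElementOf_parabolic {s : B} {l : List B} (hl : l.Nodup)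
    (hs : ∀ i, i ∈ l ↔ i ≠ s) :
    ∃ x : parabolic cs s, (x : W) = cs.wordProd l ∧
      IsCoxeterElementOf (parabolicGens cs s) x := by
  have hmem {i : B} (hi : i ≠ s) : cs.simple i ≠ cs.simple s :=
    fun h => hi (cs.simple_injective h)
  have hlift : l.map cs.simple ∈ Set.range (List.map ((↑) : parabolic cs s → W)) := by
    rw [Set.range_list_map]
    intro t ht
    obtain ⟨i, hi, rfl⟩ := List.mem_map.1 ht
    exact ⟨⟨_, cs.simple_mem_parabolic (hmem ((hs i).1 hi))⟩, rfl⟩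
  obtain ⟨m, hm⟩ := hlift
  refine ⟨m.prod, ?_, m, ?_, fun x => ?_, rfl⟩
  · rw [wordProd, ← hm, ← Subgroup.coe_subtype, map_list_prod]
  · exact List.Nodup.of_map _ (hm ▸ hl.map cs.simple_injective)
  · rw [← List.mem_map_of_injective (f := ((↑) : parabolic cs s → W)) Subtype.val_injective, hm,
      List.mem_map]
    constructor
    · rintro ⟨i, hi, hix⟩
      exact ⟨⟨i, hix⟩, hix ▸ hmem ((hs i).1 hi)⟩
    · rintro ⟨⟨i, hix⟩, hne⟩
      refine ⟨i, (hs i).2 ?_, hix⟩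
      rintro rfl
      exact hne hix.symm

omit [Finite W] in
theorem exists_word_of_isCoxeterElementOf {c : W} (hc : IsCoxeterElementOf (simpleSet cs) c) :
    ∃ l : List B, l.Nodup ∧ (∀ i, i ∈ l) ∧ cs.wordProd l = c := by
  obtain ⟨m, hm, hm', rfl⟩ := hc
  have hlift : m ∈ Set.range (List.map cs.simple) := by
    rw [Set.range_list_map]
    exact fun t ht => (hm' t).1 ht
  obtain ⟨l, rfl⟩ := hlift
  refine ⟨l, List.Nodup.of_map _ hm, fun i => ?_, rfl⟩
  have := (hm' (cs.simple i)).2 ⟨i, rfl⟩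
  rwa [List.mem_map_of_injective cs.simple_injective] at this

end CoxeterSystem

/-- **Corollary (recursion for saturated chains).**
If `(W,S)` is a finite irreducible Coxeter system with Coxeter number `h`, then for
every `k ≥ 1`, `2·SC_k(W) = h · ∑_{s∈S} SC_{k−1}(W_⟨s⟩)`. -/
theorem sc_count_recursion
    {B : Type} [Fintype B] {W : Type} [Group W] [Fintype W]
    {M : CoxeterMatrix B} (cs : CoxeterSystem M W)
    (hirr : IsIrreducibleCS cs)
    (c : W) (hc : IsCoxeterElementOf (simpleSet cs) c)
    (h : ℕ) (hh : h = orderOf c)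
    (c' : ∀ s : B, parabolic cs s)
    (hc' : ∀ s : B, IsCoxeterElementOf (parabolicGens cs s) (c' s))
    (k : ℕ) (hk : 1 ≤ k) :
    2 * scCount (simpleSet cs) c k =
      h * ∑ s : B, scCount (parabolicGens cs s) (c' s) (k - 1) := by
  classical
  obtain ⟨l, hl, hall, rfl⟩ := cs.exists_word_of_isCoxeterElementOf hc
  obtain ⟨k, rfl⟩ := Nat.exists_eq_add_of_le' hk
  choose l₁ l₂ hl₁₂ using fun i => List.append_of_mem (hall i)
  let T : Finset W := {t | IsReflectionOf (simpleSet cs) t}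
  have hT (t) : t ∈ T ↔ IsReflectionOf (simpleSet cs) t := by simp [T]
  have hT' (t) : t ∈ T ↔ ∃ w i, t = w * cs.simple i * w⁻¹ := by
    simp [hT, IsReflectionOf, simpleSet]
  rw [Nat.add_sub_cancel, scCount_succ cs.exists_reflection_word
      (by rintro _ ⟨i, rfl⟩; exact cs.simple_mul_simple_self i)
      (fun t ht => cs.absLength_reflection_mul_coxeter hl hall ht) T hT,
    ← cs.sum_conj_leftInversion hirr.2 hl hall l₁ l₂ hl₁₂ _ T hT', Finset.mul_sum, hh]
  refine Finset.sum_congr rfl fun i _ => ?_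
  obtain ⟨h1, h2⟩ := List.nodup_append_and_mem_iff_ne (hl₁₂ i ▸ hl) (hl₁₂ i ▸ hall)
  obtain ⟨x, hx, hx'⟩ := cs.exists_isCoxeterElementOf_parabolic h1 h2
  obtain ⟨g, hg⟩ := isConj_iff.1 (cs.isConj_of_isCoxeterElementOf hx' (hc' i))
  have h3 := cs.leftInversion_mul_wordProd (l₁ i) (l₂ i) i
  rw [← hl₁₂ i] at h3
  rw [← hg, scCount_conj cs.exists_reflection_word_parabolic, ← cs.scCount_parabolic h1 h2 hx, hx,
    ← h3]
  refine (Finset.sum_congr rfl fun n _ => ?_).trans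
    ((Finset.sum_const _).trans (by rw [Finset.card_range, smul_eq_mul]))
  refine Eq.trans ?_ (scCount_conj cs.exists_reflection_word (cs.wordProd l ^ n) _ k)
  congr 1
  group
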